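/- Let β > 0 be fixed, let 1 ≤ k ≤ 3, let (ε₁, ε₂, ε₃) ∈ {−1, 1}³, and for y = (y₁, …, y_k) ∈ ℕ^k set F(y) = ∑_{j=1}^{k} ε_j y_j. For a tuple x and a finite set r define 𝒯_{x,r,ε} = {y ∈ ℕ^k : y_j ∈ Set(x) ∪ r for 1 ≤ j ≤ k, {y₁,…,y_k} ∩ Set(x) ≠ ∅, and y_i = y_j implies ε_i = ε_j}. Then there exist δ_β > 0 (depending only on g and β) and, for each λ > 1, a constant C and a threshold n₀, such that for every integer n ≥ n₀, every finite set r of positive integers ≤ n with |r| ≤ 2g+4, every such k and ε: (i) ∑_{x ∈ T_n^{ind}, Set(x) ∩ r = ∅} (∏_{i=1}^{2g+4} x_i^{-α}) ∑_{y ∈ 𝒯_{x,r,ε}, F(y) ≥ 1} F(y)^{-β} ≤ C · n^{-δ_β}; and (ii) for every fixed integer r₁ ≥ n^{ε}: ∑_{x ∈ V_{r₁}, Set(x) ∩ r = ∅} (∏_{i=4}^{2g+4} x_i^{-α}) ∑_{y ∈ 𝒯_{x,r,ε}, F(y) ≥ 1} F(y)^{-β} ≤ C · n^{-δ_β}, where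 for x ∈ V_{r₁} one takes Set(x) = {x₄, …, x_{2g+4}}. The constants are independent of r and r₁. -/

import Mathlib

noncomputable section

open Real MeasureTheory ProbabilityTheory

def IsSidonZ {M : ℕ} (S : Set (ZMod M)) : Prop :=
  ∀ a ∈ S, ∀ b ∈ S, ∀ c ∈ S, ∀ d ∈ S, a + b = c + d → ({a, b} : Set (ZMod M)) = {c, d}

def Covers3 {M : ℕ} (S : Set (ZMod M)) : Prop :=
  ∀ z : ZMod M, ∃ s₁ ∈ S, ∃ s₂ ∈ S, ∃ s₃ ∈ S,
    s₁ ≠ s₂ ∧ s₁ ≠ s₃ ∧ s₂ ≠ s₃ ∧ z = s₁ + s₂ + s₃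

def alph (g : ℕ) : ℝ := ((g : ℝ) + 1) / (2 * (g : ℝ) + 1)

def glam (g : ℕ) (lam : ℝ) (n : ℕ) : ℝ :=
  lam ^ ((2 * (g : ℝ) + 5) / (1 - alph g)) * (n : ℝ) ^ ((1 : ℝ) / (g : ℝ)) *
    Real.log n ^ ((1 : ℝ) / (1 - alph g))

def GoodS (M : ℕ) (CM : Set (ZMod M)) (s : ℕ → Fin 3 → ZMod M) : Prop :=
  ∀ n : ℕ, (∀ i, s n i ∈ CM) ∧ s n 0 ≠ s n 1 ∧ s n 0 ≠ s n 2 ∧ s n 1 ≠ s n 2 ∧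
    s n 0 + s n 1 + s n 2 = (n : ZMod M)

def Rtrip (g M : ℕ) (lam : ℝ) (s : ℕ → Fin 3 → ZMod M) (n x₁ x₂ x₃ : ℕ) : Prop :=
  0 < x₁ ∧ 0 < x₂ ∧ 0 < x₃ ∧ x₁ + x₂ + x₃ = n ∧
  glam g lam n / 2 ≤ (x₁ : ℝ) ∧ (x₁ : ℝ) ≤ glam g lam n ∧
  (n : ℝ) / 4 ≤ (x₂ : ℝ) ∧ x₂ ≤ n ∧ (n : ℝ) / 4 ≤ (x₃ : ℝ) ∧ x₃ ≤ n ∧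
  (x₁ : ZMod M) = s n 0 ∧ (x₂ : ZMod M) = s n 1 ∧ (x₃ : ZMod M) = s n 2

def Rn (g M : ℕ) (lam : ℝ) (s : ℕ → Fin 3 → ZMod M) (n : ℕ) : Set (Finset ℕ) :=
  {ω | ∃ x₁ x₂ x₃ : ℕ, ω = {x₁, x₂, x₃} ∧ Rtrip g M lam s n x₁ x₂ x₃}

def imgF {m : ℕ} (x : Fin m → ℕ) : Finset ℕ := Finset.image x Finset.univ

def firstThree (g : ℕ) (x : Fin (2 * g + 4) → ℕ) : Finset ℕ :=
  {x ⟨0, by omega⟩, x ⟨1, by omega⟩, x ⟨2, by omega⟩}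

def pairOf (g : ℕ) (x : Fin (2 * g + 4) → ℕ) (j : ℕ) : Finset ℕ :=
  if j = 0 then {x ⟨0, by omega⟩, x ⟨3, by omega⟩}
  else if h : j ≤ g then {x ⟨2 * j + 2, by omega⟩, x ⟨2 * j + 3, by omega⟩}
  else ∅

def Tn (g M : ℕ) (lam : ℝ) (s : ℕ → Fin 3 → ZMod M) (n : ℕ) :
    Set (Fin (2 * g + 4) → ℕ) :=
  {x | (∀ i, 0 < x i) ∧
    firstThree g x ∈ Rn g M lam s n ∧
    (∀ j : ℕ, 2 ≤ j → ∀ _ : j ≤ g + 1,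
      x ⟨0, by omega⟩ + x ⟨3, by omega⟩ = x ⟨2 * j, by omega⟩ + x ⟨2 * j + 1, by omega⟩) ∧
    (∀ i : Fin (2 * g + 4), 3 ≤ (i : ℕ) → x i ≤ x ⟨0, by omega⟩) ∧
    (∀ k : ℕ, 2 ≤ k → ∀ _ : k ≤ g + 1,
      (x ⟨2 * k, by omega⟩ : ZMod M) = (x ⟨0, by omega⟩ : ZMod M) ∧
      (x ⟨2 * k + 1, by omega⟩ : ZMod M) = (x ⟨3, by omega⟩ : ZMod M)) ∧
    (∀ j k : ℕ, j ≤ g → k ≤ g → j ≠ k → pairOf g x j ≠ pairOf g x k)}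

def TnInd (g M : ℕ) (lam : ℝ) (s : ℕ → Fin 3 → ZMod M) (n : ℕ) :
    Set (Fin (2 * g + 4) → ℕ) :=
  {x ∈ Tn g M lam s n | Function.Injective x}

def TnDep (g M : ℕ) (lam : ℝ) (s : ℕ → Fin 3 → ZMod M) (n : ℕ) :
    Set (Fin (2 * g + 4) → ℕ) :=
  {x ∈ Tn g M lam s n | ¬ Function.Injective x}

def Vr (g : ℕ) (r₁ : ℕ) : Set (Fin (2 * g + 1) → ℕ) :=
  {v | (∀ i, 0 < v i) ∧
    (∀ t : ℕ, ∀ _ : t < g,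
      r₁ + v ⟨0, by omega⟩ = v ⟨2 * t + 1, by omega⟩ + v ⟨2 * t + 2, by omega⟩) ∧
    (∀ i, v i ≤ r₁) ∧ Function.Injective v ∧ (∀ i, v i ≠ r₁)}

def Tcal (X r : Finset ℕ) (k : ℕ) (eps : ℕ → ℤ) : Set (ℕ → ℕ) :=
  {y | (∀ j < k, y j ∈ X ∪ r) ∧ (∀ j, k ≤ j → y j = 0) ∧ (∃ j < k, y j ∈ X) ∧
    (∀ i < k, ∀ j < k, y i = y j → eps i = eps j)}

def Fval (k : ℕ) (eps : ℕ → ℤ) (y : ℕ → ℕ) : ℤ :=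
  ∑ j ∈ Finset.range k, eps j * (y j : ℤ)

def Ccal (U X r : Finset ℕ) : Set (Finset ℕ) :=
  {w | w.card = 4 ∧ w ⊆ U ∧ (∃ a ∈ w, a ∈ X ∧ a ∉ r) ∧
    ∃ y₁ y₂ y₃ y₄ : ℕ, w = {y₁, y₂, y₃, y₄} ∧ y₁ + y₂ = y₃ + y₄ ∧
      ({y₁, y₂} : Finset ℕ) ≠ {y₃, y₄}}

def CcalR (g M : ℕ) (lam : ℝ) (s : ℕ → Fin 3 → ZMod M) (n : ℕ) (X r : Finset ℕ) :
    Set (Finset ℕ) :=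
  {w | w ∈ Rn g M lam s n ∧ w ⊆ X ∪ r ∧ ∃ a ∈ w, a ∈ X ∧ a ∉ r}

def Sx (g : ℕ) (x : Fin (2 * g + 4) → ℕ) : Set (Finset ℕ) :=
  {w | ∃ l : ℕ, ∃ _ : 3 ≤ l, ∃ _ : l ≤ g + 2,
      w = ({x ⟨0, by omega⟩, x ⟨3, by omega⟩,
            x ⟨2 * l - 2, by omega⟩, x ⟨2 * l - 1, by omega⟩} : Finset ℕ)} ∪
  {w | ∃ l j : ℕ, ∃ _ : 3 ≤ l, ∃ _ : l < j, ∃ _ : j ≤ g + 2,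
      w = ({x ⟨2 * j - 2, by omega⟩, x ⟨2 * j - 1, by omega⟩,
            x ⟨2 * l - 2, by omega⟩, x ⟨2 * l - 1, by omega⟩} : Finset ℕ)}

def SxV (g : ℕ) (r₁ : ℕ) (v : Fin (2 * g + 1) → ℕ) : Set (Finset ℕ) :=
  {w | ∃ l : ℕ, ∃ _ : 3 ≤ l, ∃ _ : l ≤ g + 2,
      w = ({r₁, v ⟨0, by omega⟩, v ⟨2 * l - 5, by omega⟩, v ⟨2 * l - 4, by omega⟩} : Finset ℕ)} ∪
  {w | ∃ l j : ℕ, ∃ _ : 3 ≤ l, ∃ _ : l < j, ∃ _ : j ≤ g + 2,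
      w = ({v ⟨2 * j - 5, by omega⟩, v ⟨2 * j - 4, by omega⟩,
            v ⟨2 * l - 5, by omega⟩, v ⟨2 * l - 4, by omega⟩} : Finset ℕ)}

def tailSet (g : ℕ) (x : Fin (2 * g + 4) → ℕ) : Finset ℕ :=
  Finset.image (fun i : Fin (2 * g + 1) => x ⟨(i : ℕ) + 3, by have := i.isLt; omega⟩)
    Finset.univ

/-- The exponent `1 / (2 g + 1)`, for which `alph g = 1 - g * gam g` and `2 * alph g = 1 + gam g`. -/
def gam (g : ℕ) : ℝ := 1 / (2 * (g : ℝ) + 1)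

/-- The weight `∏ xᵢ ^ (-a)` of a tuple. -/
def wt (a : ℝ) {m : ℕ} (x : Fin m → ℕ) : ℝ := ∏ i, (x i : ℝ) ^ (-a)

/-- The affine form with integer coefficients `c` and constant term `D`. -/
def aff {m : ℕ} (c : Fin m → ℤ) (D : ℤ) (x : Fin m → ℕ) : ℤ := ∑ i, c i * (x i : ℤ) + D

/-- Coefficient vectors that arise from at most three signed summands, at least one of which is
a variable. -/
def Adm {m : ℕ} (c : Fin m → ℤ) (D : ℤ) : Prop :=
  (∃ i, c i ≠ 0) ∧ ∑ i, |c i| ≤ 3 ∧ (D = 0 ∨ ∑ i, |c i| ≤ 2)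

lemma gam_pos (g : ℕ) : 0 < gam g := by unfold gam; positivity

lemma alph_eq_one_sub (g : ℕ) : alph g = 1 - g * gam g := by
  unfold alph gam; field_simp; ring

lemma two_mul_alph (g : ℕ) : 2 * alph g = 1 + gam g := by
  unfold alph gam; field_simp; ring

lemma gam_le_one (g : ℕ) : gam g ≤ 1 := by
  unfold gam
  rw [div_le_one (by positivity)]
  have : (0 : ℝ) ≤ g := Nat.cast_nonneg g
  linarith

lemma alph_pos (g : ℕ) : 0 < alph g := by unfold alph; positivity

lemma alph_lt_one {g : ℕ} (hg : 0 < g) : alph g < 1 := by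
  rw [alph_eq_one_sub]
  have : (0 : ℝ) < g := Nat.cast_pos.2 hg
  nlinarith [mul_pos this (gam_pos g)]

lemma wt_nonneg (a : ℝ) {m : ℕ} (x : Fin m → ℕ) : 0 ≤ wt a x :=
  Finset.prod_nonneg fun i _ => by positivity

lemma sum_Icc_rpow_neg_le {a : ℝ} (ha0 : 0 ≤ a) (ha : a < 1) (N : ℕ) :
    ∑ i ∈ Finset.Icc 1 N, (i : ℝ) ^ (-a) ≤ (N : ℝ) ^ (1 - a) / (1 - a) := by
  have h1 : 0 < 1 - a := by linarith
  induction N with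
  | zero => simp [Real.zero_rpow h1.ne']
  | succ N ih =>
    rw [Finset.sum_Icc_succ_top (by omega)]
    have hN : (0 : ℝ) < (N : ℝ) + 1 := by positivity
    have hb := rpow_one_add_le_one_add_mul_self (s := -1 / ((N : ℝ) + 1)) (p := 1 - a)
      (by rw [le_div_iff₀ hN]; have : (0 : ℝ) ≤ N := Nat.cast_nonneg N; linarith) h1.le
      (by linarith)
    have e1 : 1 + -1 / ((N : ℝ) + 1) = N / (N + 1) := by field_simp; ring
    rw [e1, Real.div_rpow (Nat.cast_nonneg N) hN.le, div_le_iff₀ (by positivity)] at hb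
    have e2 : ((N : ℝ) + 1) ^ (1 - a) = ((N : ℝ) + 1) ^ (-a) * (N + 1) := by
      rw [sub_eq_neg_add, Real.rpow_add_one hN.ne']
    have e3 : (1 + (1 - a) * (-1 / ((N : ℝ) + 1))) * ((N : ℝ) + 1) ^ (1 - a)
        = ((N : ℝ) + 1) ^ (1 - a) - (1 - a) * ((N : ℝ) + 1) ^ (-a) := by
      rw [e2]; field_simp; ring
    rw [e3] at hb
    push_cast
    rw [le_div_iff₀ h1] at ih ⊢
    linarith

lemma sum_rpow_neg_le_of_le {a : ℝ} (ha0 : 0 ≤ a) (ha : a < 1) {G : ℝ} (hG : 0 ≤ G)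
    {U : Finset ℕ} (hU : ∀ u ∈ U, 1 ≤ u ∧ (u : ℝ) ≤ G) :
    ∑ u ∈ U, (u : ℝ) ^ (-a) ≤ G ^ (1 - a) / (1 - a) := by
  have hsub : U ⊆ Finset.Icc 1 ⌊G⌋₊ := fun u hu =>
    Finset.mem_Icc.2 ⟨(hU u hu).1, Nat.le_floor (hU u hu).2⟩
  calc _ ≤ ∑ u ∈ Finset.Icc 1 ⌊G⌋₊, (u : ℝ) ^ (-a) :=
        Finset.sum_le_sum_of_subset_of_nonneg hsub fun i _ _ => by positivity
    _ ≤ (⌊G⌋₊ : ℝ) ^ (1 - a) / (1 - a) := sum_Icc_rpow_neg_le ha0 ha _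
    _ ≤ _ := by
        have h1 : 0 < 1 - a := by linarith
        gcongr
        exact Nat.floor_le hG

lemma rpow_neg_le_one_of_pos {a : ℝ} (ha : 0 ≤ a) {x : ℕ} (hx : 0 < x) :
    (x : ℝ) ^ (-a) ≤ 1 :=
  Real.rpow_le_one_of_one_le_of_nonpos (by exact_mod_cast hx) (by linarith)

lemma half_rpow_neg_le {a : ℝ} (ha : a ≤ 1) {m : ℝ} (hm : 0 < m) :
    (m / 2) ^ (-a) ≤ 2 * m ^ (-a) := by
  rw [Real.div_rpow hm.le (by norm_num), Real.rpow_neg (by norm_num : (0 : ℝ) ≤ 2), div_inv_eq_mul,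
    mul_comm]
  gcongr
  calc (2 : ℝ) ^ a ≤ 2 ^ (1 : ℝ) := Real.rpow_le_rpow_of_exponent_le (by norm_num) ha
    _ = 2 := by norm_num

lemma mul_rpow_neg_le {a : ℝ} (ha0 : 0 ≤ a) (ha : a ≤ 1) {x y : ℕ} (hx : 0 < x) (hy : 0 < y) :
    (x : ℝ) ^ (-a) * (y : ℝ) ^ (-a) ≤
      2 * ((x : ℝ) + y) ^ (-a) * min 1 ((x : ℝ) ^ (-a) + (y : ℝ) ^ (-a)) := by
  wlog hxy : x ≤ y generalizing x y
  · have := this hy hx (by omega)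
    rwa [mul_comm, add_comm (y : ℝ), add_comm ((y : ℝ) ^ (-a))] at this
  have hx' : (0 : ℝ) < x := by exact_mod_cast hx
  have hxy' : (x : ℝ) ≤ y := by exact_mod_cast hxy
  have h1 : (y : ℝ) ^ (-a) ≤ 2 * ((x : ℝ) + y) ^ (-a) :=
    (Real.rpow_le_rpow_of_nonpos (by linarith) (by linarith) (by linarith)).trans
      (half_rpow_neg_le ha (by linarith))
  rw [mul_comm]
  refine mul_le_mul h1 (le_min (rpow_neg_le_one_of_pos ha0 hx) ?_) (by positivity) (by positivity)
  have : (0 : ℝ) ≤ (y : ℝ) ^ (-a) := by positivity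
  linarith

lemma sum_pair_rpow_le {a : ℝ} (ha0 : 0 ≤ a) (ha : a < 1) (m : ℕ) (hm : 0 < m) :
    ∑ x ∈ Finset.Icc 1 (m - 1), (x : ℝ) ^ (-a) * ((m - x : ℕ) : ℝ) ^ (-a) ≤
      4 / (1 - a) * (m : ℝ) ^ (1 - 2 * a) := by
  have h1 : 0 < 1 - a := by linarith
  have hm' : (0 : ℝ) < m := by exact_mod_cast hm
  have hS : ∑ x ∈ Finset.Icc 1 (m - 1), (x : ℝ) ^ (-a) ≤ (m : ℝ) ^ (1 - a) / (1 - a) :=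
    sum_rpow_neg_le_of_le ha0 ha hm'.le fun u hu => by
      rw [Finset.mem_Icc] at hu
      exact ⟨hu.1, by exact_mod_cast (by omega : u ≤ m)⟩
  have hS' : ∑ x ∈ Finset.Icc 1 (m - 1), ((m - x : ℕ) : ℝ) ^ (-a)
      = ∑ x ∈ Finset.Icc 1 (m - 1), (x : ℝ) ^ (-a) := by
    refine Finset.sum_nbij' (fun x => m - x) (fun x => m - x) ?_ ?_ ?_ ?_ ?_ <;>
      intro x hx <;> simp only [Finset.mem_Icc] at * <;> omega
  calc _ ≤ ∑ x ∈ Finset.Icc 1 (m - 1),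
        2 * (m : ℝ) ^ (-a) * ((x : ℝ) ^ (-a) + ((m - x : ℕ) : ℝ) ^ (-a)) := by
        refine Finset.sum_le_sum fun x hx => ?_
        rw [Finset.mem_Icc] at hx
        have h := mul_rpow_neg_le ha0 ha.le (x := x) (y := m - x) (by omega) (by omega)
        have e : (x : ℝ) + ((m - x : ℕ) : ℝ) = m := by
          rw [← Nat.cast_add]; congr 1; omega
        rw [e] at h
        refine h.trans ?_
        gcongr
        exact min_le_right _ _
    _ ≤ 2 * (m : ℝ) ^ (-a) * ((m : ℝ) ^ (1 - a) / (1 - a) + (m : ℝ) ^ (1 - a) / (1 - a)) := by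
        rw [← Finset.mul_sum, Finset.sum_add_distrib, hS']
        gcongr
    _ = 4 / (1 - a) * (m : ℝ) ^ (1 - 2 * a) := by
        rw [show 1 - 2 * a = -a + (1 - a) by ring, Real.rpow_add hm']
        field_simp; ring

lemma sum_le_sum_of_map {ι κ : Type*} {s : Finset ι} {t : Finset κ} (e : ι → κ)
    (he : ∀ i ∈ s, e i ∈ t) (hinj : Set.InjOn e s) {f : ι → ℝ} {h : κ → ℝ}
    (hf : ∀ i ∈ s, f i ≤ h (e i)) (hh : ∀ j ∈ t, 0 ≤ h j) : ∑ i ∈ s, f i ≤ ∑ j ∈ t, h j := by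
  classical
  calc _ ≤ ∑ i ∈ s, h (e i) := Finset.sum_le_sum hf
    _ = ∑ j ∈ s.image e, h j := (Finset.sum_image hinj).symm
    _ ≤ _ := Finset.sum_le_sum_of_subset_of_nonneg (Finset.image_subset_iff.2 he)
        fun j hj _ => hh j hj

/-- If a weighted sum has small mass on each level set of an integer function `Φ`, then weighting
by `Φ ^ (-β)` gains a factor. -/
lemma sum_rpow_neg_le_of_levels {ι : Type*} (s : Finset ι) {w : ι → ℝ} (hw : ∀ i ∈ s, 0 ≤ w i)
    (Φ : ι → ℤ) {β K M S : ℝ} (hβ : 0 ≤ β) (hK : 0 < K) (hM : 0 ≤ M)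
    (hlev : ∀ f : ℤ, 1 ≤ f → (f : ℝ) < K → ∑ i ∈ s with Φ i = f, w i ≤ M)
    (hS : ∑ i ∈ s, w i ≤ S) :
    ∑ i ∈ s with 1 ≤ Φ i, w i * (Φ i : ℝ) ^ (-β) ≤ K * M + K ^ (-β) * S := by
  rw [← Finset.sum_filter_add_sum_filter_not (s.filter fun i => 1 ≤ Φ i)
    (fun i => (Φ i : ℝ) < K)]
  refine add_le_add ?_ ?_
  · calc _ ≤ ∑ i ∈ (s.filter fun i => 1 ≤ Φ i).filter (fun i => (Φ i : ℝ) < K), w i := by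
          refine Finset.sum_le_sum fun i hi => ?_
          simp only [Finset.mem_filter] at hi
          have h1 : (1 : ℝ) ≤ Φ i := by exact_mod_cast hi.1.2
          exact mul_le_of_le_one_right (hw i hi.1.1)
            (Real.rpow_le_one_of_one_le_of_nonpos h1 (by linarith))
      _ = ∑ f ∈ Finset.Ico 1 ⌈K⌉, ∑ i ∈ (s.filter fun i => 1 ≤ Φ i).filter
            (fun i => (Φ i : ℝ) < K) with Φ i = f, w i := by
          refine (Finset.sum_fiberwise_of_maps_to (fun i hi => ?_) _).symm
          simp only [Finset.mem_filter] at hi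
          exact Finset.mem_Ico.2 ⟨hi.1.2, Int.lt_ceil.2 hi.2⟩
      _ ≤ ∑ f ∈ Finset.Ico 1 ⌈K⌉, M := by
          refine Finset.sum_le_sum fun f hf => ?_
          rw [Finset.mem_Ico, Int.lt_ceil] at hf
          refine le_trans (Finset.sum_le_sum_of_subset_of_nonneg ?_ ?_) (hlev f hf.1 hf.2)
          · intro i hi
            simp only [Finset.mem_filter] at hi ⊢
            exact ⟨hi.1.1.1, hi.2⟩
          · intro i hi _
            exact hw i (Finset.mem_filter.1 hi).1
      _ ≤ K * M := by
          rw [Finset.sum_const, Int.card_Ico, nsmul_eq_mul]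
          gcongr
          have h2 : (0 : ℤ) ≤ ⌈K⌉ - 1 := by
            have := Int.ceil_pos.2 hK
            omega
          have h3 : (((⌈K⌉ - 1).toNat : ℤ) : ℝ) = (⌈K⌉ : ℝ) - 1 := by
            rw [Int.toNat_of_nonneg h2]; push_cast; ring
          rw [Int.cast_natCast] at h3
          rw [h3]
          linarith [Int.ceil_lt_add_one K]
  · calc _ ≤ ∑ i ∈ (s.filter fun i => 1 ≤ Φ i).filter (fun i => ¬ (Φ i : ℝ) < K),
          K ^ (-β) * w i := by
          refine Finset.sum_le_sum fun i hi => ?_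
          simp only [Finset.mem_filter, not_lt] at hi
          rw [mul_comm]
          refine mul_le_mul_of_nonneg_right ?_ (hw i hi.1.1)
          exact Real.rpow_le_rpow_of_nonpos hK hi.2 (by linarith)
      _ ≤ ∑ i ∈ s, K ^ (-β) * w i := by
          refine Finset.sum_le_sum_of_subset_of_nonneg ?_ ?_
          · exact (Finset.filter_subset _ _).trans (Finset.filter_subset _ _)
          · intro i hi _
            have := hw i hi
            positivity
      _ ≤ _ := by
          rw [← Finset.mul_sum]
          gcongr

@[to_additive]
lemma prod_range_pairs {A : Type*} [CommMonoid A] (f : ℕ → A) (g : ℕ) :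
    ∏ i ∈ Finset.range (2 * g + 1), f i =
      f 0 * ∏ t ∈ Finset.range g, (f (2 * t + 1) * f (2 * t + 2)) := by
  induction g with
  | zero => simp
  | succ g ih =>
    rw [show 2 * (g + 1) + 1 = 2 * g + 1 + 1 + 1 by ring, Finset.prod_range_succ,
      Finset.prod_range_succ, ih, Finset.prod_range_succ, mul_assoc, mul_assoc]

@[to_additive]
lemma prod_fin_pairs {A : Type*} [CommMonoid A] {g : ℕ} (f : Fin (2 * g + 1) → A) :
    ∏ i, f i = f ⟨0, by omega⟩ *
      ∏ t : Fin g, (f ⟨2 * t + 1, by omega⟩ * f ⟨2 * t + 2, by omega⟩) := by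
  have h := prod_range_pairs (fun i => if h : i < 2 * g + 1 then f ⟨i, h⟩ else 1) g
  rw [← Fin.prod_univ_eq_prod_range
      (fun i => if h : i < 2 * g + 1 then f ⟨i, h⟩ else 1) (2 * g + 1),
    ← Fin.prod_univ_eq_prod_range (fun t => (if h : 2 * t + 1 < 2 * g + 1 then f ⟨2 * t + 1, h⟩
      else 1) * (if h : 2 * t + 2 < 2 * g + 1 then f ⟨2 * t + 2, h⟩ else 1)) g] at h
  simp only [Fin.is_lt, dif_pos, Fin.eta] at h
  rw [h, dif_pos (by omega)]
  congr 1
  refine Finset.prod_congr rfl fun t _ => ?_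
  rw [dif_pos (by omega), dif_pos (by omega)]

lemma Vr_snd {g r₁ : ℕ} {v : Fin (2 * g + 1) → ℕ} (hv : v ∈ Vr g r₁) (t : Fin g) :
    v ⟨2 * t + 2, by omega⟩ = r₁ + v ⟨0, by omega⟩ - v ⟨2 * t + 1, by omega⟩ := by
  have := hv.2.1 t t.2
  omega

lemma Vr_ext {g r₁ : ℕ} {v w : Fin (2 * g + 1) → ℕ} (hv : v ∈ Vr g r₁) (hw : w ∈ Vr g r₁)
    (h0 : v ⟨0, by omega⟩ = w ⟨0, by omega⟩)
    (h : ∀ t : Fin g, v ⟨2 * t + 1, by omega⟩ = w ⟨2 * t + 1, by omega⟩) : v = w := by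
  funext ⟨i, hi⟩
  rcases Nat.even_or_odd' i with ⟨j, rfl | rfl⟩
  · rcases j with _ | j
    · exact h0
    · have h1 := Vr_snd hv ⟨j, by omega⟩
      have h2 := Vr_snd hw ⟨j, by omega⟩
      have h3 := h ⟨j, by omega⟩
      simp only [h0, h3] at h1 h2
      exact h1.trans h2.symm
  · exact h ⟨j, by omega⟩

/-- Mass of a set of tuples in `Vr g r₁` whose first coordinate lies in `U` and which are determined
by their coordinates outside the pairs indexed by `O`. -/
lemma sum_wt_Vr_le {g r₁ : ℕ} {a : ℝ} (ha0 : 0 ≤ a) (ha : a < 1) (h2a : 1 ≤ 2 * a) (hr : 0 < r₁)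
    (T : Finset (Fin (2 * g + 1) → ℕ)) (hT : ∀ v ∈ T, v ∈ Vr g r₁) (U : Finset ℕ)
    (hU : ∀ v ∈ T, v ⟨0, by omega⟩ ∈ U) (O : Fin g → Prop) [DecidablePred O]
    (hinj : ∀ v ∈ T, ∀ w ∈ T, v ⟨0, by omega⟩ = w ⟨0, by omega⟩ →
      (∀ t, ¬ O t → v ⟨2 * t + 1, by omega⟩ = w ⟨2 * t + 1, by omega⟩) → v = w) :
    ∑ v ∈ T, wt a v ≤ (∑ u ∈ U, (u : ℝ) ^ (-a)) *
      ∏ t : Fin g, (if O t then 2 * (r₁ : ℝ) ^ (-a)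
        else 4 / (1 - a) * (r₁ : ℝ) ^ (1 - 2 * a)) := by
  classical
  have hr' : (0 : ℝ) < r₁ := by exact_mod_cast hr
  have h1a : 0 < 1 - a := by linarith
  let q : ℕ → Fin g → ℕ → ℝ := fun u t x =>
    if O t then 2 * (r₁ : ℝ) ^ (-a) else (x : ℝ) ^ (-a) * ((r₁ + u - x : ℕ) : ℝ) ^ (-a)
  have hq : ∀ u t x, 0 ≤ q u t x := by
    intro u t x
    simp only [q]
    split_ifs <;> positivity
  let S : ℕ → Fin g → Finset ℕ := fun u t => if O t then {1} else Finset.Icc 1 (r₁ + u - 1)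
  let e : (Fin (2 * g + 1) → ℕ) → (_ : ℕ) × (Fin g → ℕ) := fun v =>
    ⟨v ⟨0, by omega⟩, fun t => if O t then 1 else v ⟨2 * t + 1, by omega⟩⟩
  have key : ∑ v ∈ T, wt a v ≤
      ∑ p ∈ U.sigma (fun u => Fintype.piFinset (S u)),
        (p.1 : ℝ) ^ (-a) * ∏ t, q p.1 t (p.2 t) := by
    refine sum_le_sum_of_map e ?_ ?_ ?_ ?_
    · intro v hv
      refine Finset.mem_sigma.2 ⟨hU v hv, Fintype.mem_piFinset.2 fun t => ?_⟩
      simp only [e, S]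
      split_ifs
      · simp
      · have h1 := (hT v hv).2.1 t t.2
        have h2 := (hT v hv).1 ⟨2 * t + 1, by omega⟩
        have h3 := (hT v hv).1 ⟨2 * t + 2, by omega⟩
        rw [Finset.mem_Icc]
        omega
    · intro v hv w hw hvw
      simp only [e, Sigma.mk.injEq, heq_eq_eq] at hvw
      refine hinj v hv w hw hvw.1 fun t ht => ?_
      have := congrFun hvw.2 t
      simpa [ht] using this
    · intro v hv
      rw [wt, prod_fin_pairs]
      refine mul_le_mul_of_nonneg_left (Finset.prod_le_prod (fun t _ => by positivity) ?_)
        (by positivity)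
      intro t _
      simp only [e, q]
      split_ifs with ht
      · have h2 := (hT v hv).1 ⟨2 * t + 1, by omega⟩
        have h3 := (hT v hv).1 ⟨2 * t + 2, by omega⟩
        refine (mul_rpow_neg_le ha0 ha.le h2 h3).trans ?_
        rw [← Nat.cast_add, ← (hT v hv).2.1 t t.2, ← mul_one (2 * (r₁ : ℝ) ^ (-a))]
        refine mul_le_mul ?_ (min_le_left _ _) (by positivity) (by positivity)
        refine mul_le_mul_of_nonneg_left ?_ (by norm_num)
        refine Real.rpow_le_rpow_of_nonpos hr' ?_ (by linarith)
        push_cast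
        linarith [Nat.cast_nonneg (α := ℝ) (v ⟨0, by omega⟩)]
      · rw [Vr_snd (hT v hv) t]
    · intro p _
      exact mul_nonneg (by positivity) (Finset.prod_nonneg fun t _ => hq _ _ _)
  refine key.trans ?_
  rw [Finset.sum_sigma, Finset.sum_mul]
  refine Finset.sum_le_sum fun u _ => ?_
  dsimp only
  rw [← Finset.mul_sum, ← Finset.prod_univ_sum]
  refine mul_le_mul_of_nonneg_left (Finset.prod_le_prod
    (fun t _ => Finset.sum_nonneg fun x _ => hq _ _ _) ?_) (by positivity)
  intro t _
  simp only [S, q]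
  split_ifs with ht
  · simp
  · refine (sum_pair_rpow_le ha0 ha (r₁ + u) (by omega)).trans ?_
    refine mul_le_mul_of_nonneg_left ?_ (by positivity)
    refine Real.rpow_le_rpow_of_nonpos hr' ?_ (by linarith)
    push_cast
    linarith [Nat.cast_nonneg (α := ℝ) u]

/-- The constant bounding the total mass of `Vr g r₁`. -/
def tailConst (g : ℕ) : ℝ := (4 / (1 - alph g)) ^ g / (1 - alph g)

lemma four_le_div {g : ℕ} (hg : 0 < g) : 4 ≤ 4 / (1 - alph g) := by
  rw [le_div_iff₀ (by linarith [alph_lt_one hg])]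
  linarith [alph_pos g]

lemma tailConst_pos {g : ℕ} (hg : 0 < g) : 0 < tailConst g := by
  have := alph_lt_one hg
  have : 0 < 1 - alph g := by linarith
  unfold tailConst
  positivity

lemma rpow_gam_pow {g : ℕ} {R : ℝ} (hR : 0 < R) (B : ℝ) :
    (B * R ^ (1 - 2 * alph g)) ^ g = B ^ g * R ^ (-(g * gam g)) := by
  rw [mul_pow, ← Real.rpow_natCast (R ^ _), ← Real.rpow_mul hR.le, two_mul_alph]
  ring_nf

lemma sum_wt_Vr_le_const {g r₁ : ℕ} (hg : 0 < g) (hr : 0 < r₁)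
    (T : Finset (Fin (2 * g + 1) → ℕ)) (hT : ∀ v ∈ T, v ∈ Vr g r₁) :
    ∑ v ∈ T, wt (alph g) v ≤ tailConst g := by
  have hr' : (0 : ℝ) < r₁ := by exact_mod_cast hr
  have ha := alph_lt_one hg
  have h1a : 0 < 1 - alph g := by linarith
  refine (sum_wt_Vr_le (alph_pos g).le ha (by linarith [two_mul_alph g, gam_pos g]) hr T hT
    (Finset.Icc 1 r₁) (fun v hv => Finset.mem_Icc.2 ⟨(hT v hv).1 _, (hT v hv).2.2.1 _⟩)
    (fun _ => False) ?_).trans ?_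
  · intro v hv w hw h0 h
    exact Vr_ext (hT v hv) (hT w hw) h0 fun t => h t not_false
  · simp only [if_false, Finset.prod_const, Finset.card_univ, Fintype.card_fin]
    rw [rpow_gam_pow hr']
    calc _ ≤ (r₁ : ℝ) ^ (1 - alph g) / (1 - alph g) *
          ((4 / (1 - alph g)) ^ g * (r₁ : ℝ) ^ (-(g * gam g))) := by
          gcongr
          exact sum_Icc_rpow_neg_le (alph_pos g).le ha r₁
      _ = tailConst g := by
          rw [tailConst, show 1 - alph g = g * gam g by rw [alph_eq_one_sub]; ring,
            Real.rpow_neg hr'.le]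
          field_simp

lemma sum_wt_Vr_le_of_fst {g r₁ : ℕ} (hg : 0 < g) (hr : 0 < r₁)
    (T : Finset (Fin (2 * g + 1) → ℕ)) (hT : ∀ v ∈ T, v ∈ Vr g r₁)
    (hc : ∀ v ∈ T, ∀ w ∈ T, v ⟨0, by omega⟩ = w ⟨0, by omega⟩) :
    ∑ v ∈ T, wt (alph g) v ≤ tailConst g * (r₁ : ℝ) ^ (-(g * gam g)) := by
  have hr' : (0 : ℝ) < r₁ := by exact_mod_cast hr
  have ha := alph_lt_one hg
  have h1a : 0 < 1 - alph g := by linarith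
  have := tailConst_pos hg
  rcases T.eq_empty_or_nonempty with rfl | ⟨v₀, hv₀⟩
  · simp only [Finset.sum_empty]; positivity
  refine (sum_wt_Vr_le (alph_pos g).le ha (by linarith [two_mul_alph g, gam_pos g]) hr T hT
    {v₀ ⟨0, by omega⟩} (fun v hv => Finset.mem_singleton.2 (hc v hv v₀ hv₀))
    (fun _ => False) ?_).trans ?_
  · intro v hv w hw h0 h
    exact Vr_ext (hT v hv) (hT w hw) h0 fun t => h t not_false
  · simp only [if_false, Finset.prod_const, Finset.card_univ, Fintype.card_fin,
      Finset.sum_singleton]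
    rw [rpow_gam_pow hr', tailConst, ← mul_assoc]
    refine mul_le_mul_of_nonneg_right ?_ (by positivity)
    calc _ ≤ 1 * (4 / (1 - alph g)) ^ g := by
          gcongr
          exact rpow_neg_le_one_of_pos (alph_pos g).le ((hT v₀ hv₀).1 _)
      _ ≤ _ := by
          rw [one_mul, le_div_iff₀ h1a]
          refine mul_le_of_le_one_right (by positivity) ?_
          linarith [alph_pos g]

lemma sum_wt_Vr_le_of_pair {g r₁ : ℕ} (hg : 0 < g) (hr : 0 < r₁)
    (T : Finset (Fin (2 * g + 1) → ℕ)) (hT : ∀ v ∈ T, v ∈ Vr g r₁) (t₀ : Fin g)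
    (hinj : ∀ v ∈ T, ∀ w ∈ T, v ⟨0, by omega⟩ = w ⟨0, by omega⟩ →
      (∀ t, t ≠ t₀ → v ⟨2 * t + 1, by omega⟩ = w ⟨2 * t + 1, by omega⟩) → v = w) :
    ∑ v ∈ T, wt (alph g) v ≤ tailConst g * (r₁ : ℝ) ^ (-(g * gam g)) := by
  have hr' : (0 : ℝ) < r₁ := by exact_mod_cast hr
  have ha := alph_lt_one hg
  have h1a : 0 < 1 - alph g := by linarith
  refine (sum_wt_Vr_le (alph_pos g).le ha (by linarith [two_mul_alph g, gam_pos g]) hr T hT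
    (Finset.Icc 1 r₁) (fun v hv => Finset.mem_Icc.2 ⟨(hT v hv).1 _, (hT v hv).2.2.1 _⟩)
    (fun t => t = t₀) hinj).trans ?_
  have hprod : ∏ t : Fin g, (if t = t₀ then 2 * (r₁ : ℝ) ^ (-alph g)
        else 4 / (1 - alph g) * (r₁ : ℝ) ^ (1 - 2 * alph g)) ≤
      (4 / (1 - alph g)) ^ g * (r₁ : ℝ) ^ (-(g * gam g)) * (r₁ : ℝ) ^ (-(g * gam g)) := by
    calc _ ≤ ∏ t : Fin g, (4 / (1 - alph g) * (r₁ : ℝ) ^ (1 - 2 * alph g)) *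
          (if t = t₀ then (r₁ : ℝ) ^ (-(g * gam g)) else 1) := by
          refine Finset.prod_le_prod (fun t _ => by split_ifs <;> positivity) fun t _ => ?_
          split_ifs
          · rw [mul_assoc, ← Real.rpow_add hr', show 1 - 2 * alph g + -(g * gam g) = -alph g by
              rw [alph_eq_one_sub]; have := two_mul_alph g; rw [alph_eq_one_sub] at this; linarith]
            gcongr
            linarith [four_le_div hg]
          · rw [mul_one]
      _ = _ := by
          rw [Finset.prod_mul_distrib, Finset.prod_const, Finset.prod_ite_eq' Finset.univ t₀,
            Finset.card_univ, Fintype.card_fin, rpow_gam_pow hr', if_pos (Finset.mem_univ _)]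
  calc _ ≤ (r₁ : ℝ) ^ (1 - alph g) / (1 - alph g) * ((4 / (1 - alph g)) ^ g *
          (r₁ : ℝ) ^ (-(g * gam g)) * (r₁ : ℝ) ^ (-(g * gam g))) :=
        mul_le_mul (sum_Icc_rpow_neg_le (alph_pos g).le ha r₁) hprod
          (Finset.prod_nonneg fun t _ => by split_ifs <;> positivity) (by positivity)
    _ = _ := by
        rw [tailConst, show 1 - alph g = g * gam g by rw [alph_eq_one_sub]; ring,
          Real.rpow_neg hr'.le]
        field_simp

lemma aff_eq_of_Vr {g r₁ : ℕ} (c : Fin (2 * g + 1) → ℤ) (D : ℤ) {v : Fin (2 * g + 1) → ℕ}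
    (hv : v ∈ Vr g r₁) :
    aff c D v = c ⟨0, by omega⟩ * (v ⟨0, by omega⟩ : ℤ) +
      ∑ t : Fin g, (c ⟨2 * t + 1, by omega⟩ * (v ⟨2 * t + 1, by omega⟩ : ℤ) +
        c ⟨2 * t + 2, by omega⟩ *
          ((r₁ : ℤ) + v ⟨0, by omega⟩ - v ⟨2 * t + 1, by omega⟩)) + D := by
  rw [aff, sum_fin_pairs]
  congr 2
  refine Finset.sum_congr rfl fun t _ => ?_
  have h := hv.2.1 t t.2
  zify at h
  rw [show (v ⟨2 * t + 2, by omega⟩ : ℤ) = r₁ + v ⟨0, by omega⟩ - v ⟨2 * t + 1, by omega⟩ by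
    linarith]

lemma two_dvd_sum_abs_sub {ι : Type*} (s : Finset ι) (c : ι → ℤ) :
    2 ∣ ∑ i ∈ s, |c i| - ∑ i ∈ s, c i := by
  rw [← Finset.sum_sub_distrib]
  refine Finset.dvd_sum fun i _ => ?_
  rcases abs_choice (c i) with h | h <;> omega

lemma sum_wt_Vr_level_le {g r₁ : ℕ} (hg : 0 < g) (hr : 0 < r₁) {c : Fin (2 * g + 1) → ℤ} {D : ℤ}
    (hc : Adm c D) {f : ℤ} (hf : 1 ≤ f) (hfr : f < r₁)
    (T : Finset (Fin (2 * g + 1) → ℕ)) (hT : ∀ v ∈ T, v ∈ Vr g r₁)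
    (hTf : ∀ v ∈ T, aff c D v = f) :
    ∑ v ∈ T, wt (alph g) v ≤ tailConst g * (r₁ : ℝ) ^ (-(g * gam g)) := by
  by_cases hA : ∃ t : Fin g, c ⟨2 * t + 1, by omega⟩ ≠ c ⟨2 * t + 2, by omega⟩
  · obtain ⟨t₀, ht₀⟩ := hA
    refine sum_wt_Vr_le_of_pair hg hr T hT t₀ fun v hv w hw h0 h => ?_
    refine Vr_ext (hT v hv) (hT w hw) h0 fun t => ?_
    by_cases ht : t = t₀
    · subst ht
      have e := (hTf v hv).trans (hTf w hw).symm
      rw [aff_eq_of_Vr c D (hT v hv), aff_eq_of_Vr c D (hT w hw), h0,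
        ← Finset.add_sum_erase _ _ (Finset.mem_univ t),
        ← Finset.add_sum_erase Finset.univ (fun t : Fin g => _ * (w _ : ℤ) + _)
          (Finset.mem_univ t),
        Finset.sum_congr (s₁ := Finset.univ.erase t) rfl
          (fun i hi => by rw [h i (Finset.ne_of_mem_erase hi)])] at e
      have e' : (c ⟨2 * t + 1, by omega⟩ - c ⟨2 * t + 2, by omega⟩) *
          ((v ⟨2 * t + 1, by omega⟩ : ℤ) - w ⟨2 * t + 1, by omega⟩) = 0 := by
        linear_combination e
      rcases mul_eq_zero.1 e' with h' | h'
      · exact absurd (sub_eq_zero.1 h') ht₀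
      · exact_mod_cast sub_eq_zero.1 h'
    · exact h t ht
  · push Not at hA
    have haff : ∀ v ∈ T, (c ⟨0, by omega⟩ + ∑ t : Fin g, c ⟨2 * t + 1, by omega⟩) *
        (v ⟨0, by omega⟩ : ℤ) + (∑ t : Fin g, c ⟨2 * t + 1, by omega⟩) * r₁ + D = f := by
      intro v hv
      rw [← hTf v hv, aff_eq_of_Vr c D (hT v hv), add_mul, Finset.sum_mul, Finset.sum_mul,
        add_assoc (c _ * _), ← Finset.sum_add_distrib]
      congr 2
      refine Finset.sum_congr rfl fun t _ => ?_
      rw [← hA t]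
      ring
    by_cases h0 : c ⟨0, by omega⟩ + ∑ t : Fin g, c ⟨2 * t + 1, by omega⟩ = 0
    · rcases T.eq_empty_or_nonempty with rfl | ⟨v, hv⟩
      · have := tailConst_pos hg
        simp only [Finset.sum_empty]
        positivity
      exfalso
      have e := haff v hv
      rw [h0, zero_mul, zero_add] at e
      obtain ⟨⟨i, hi⟩, hc3, hcD⟩ := hc
      rw [sum_fin_pairs] at hc3 hcD
      have hs : ∑ t : Fin g, (|c ⟨2 * t + 1, by omega⟩| + |c ⟨2 * t + 2, by omega⟩|) =
          2 * ∑ t : Fin g, |c ⟨2 * t + 1, by omega⟩| := by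
        rw [Finset.mul_sum]
        refine Finset.sum_congr rfl fun t _ => ?_
        rw [← hA t]
        ring
      rw [hs] at hc3 hcD
      have hpar := two_dvd_sum_abs_sub Finset.univ (fun t : Fin g => c ⟨2 * t + 1, by omega⟩)
      have habs := Finset.abs_sum_le_sum_abs (fun t : Fin g => c ⟨2 * t + 1, by omega⟩)
        Finset.univ
      have hpos : 1 ≤ ∑ t : Fin g, |c ⟨2 * t + 1, by omega⟩| := by
        by_contra hlt
        have hz : ∑ t : Fin g, |c ⟨2 * t + 1, by omega⟩| = 0 :=
          le_antisymm (by omega) (Finset.sum_nonneg fun _ _ => abs_nonneg _)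
        have hz' : ∀ t : Fin g, c ⟨2 * t + 1, by omega⟩ = 0 := fun t => abs_eq_zero.1
          ((Finset.sum_eq_zero_iff_of_nonneg fun _ _ => abs_nonneg _).1 hz t (Finset.mem_univ t))
        have hz0 : c ⟨0, by omega⟩ = 0 := by
          simpa [hz'] using h0
        refine hi ?_
        obtain ⟨i, hi'⟩ := i
        rcases Nat.even_or_odd' i with ⟨j, rfl | rfl⟩
        · rcases j with _ | j
          · exact hz0
          · exact (hA ⟨j, by omega⟩).symm.trans (hz' ⟨j, by omega⟩)
        · exact hz' ⟨j, by omega⟩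
      generalize (∑ t : Fin g, |c ⟨2 * t + 1, by omega⟩|) = B at *
      generalize (∑ t : Fin g, c ⟨2 * t + 1, by omega⟩) = A at *
      have hB : B = 1 := by
        have := abs_nonneg (c ⟨0, by omega⟩)
        omega
      have hA1 : A = 1 ∨ A = -1 := by
        rw [hB, abs_le] at habs
        omega
      have hc1 : |c ⟨0, by omega⟩| = 1 := by
        rw [show c ⟨0, by omega⟩ = -A by linarith]
        rcases hA1 with rfl | rfl <;> rfl
      have hD : D = 0 := by omega
      rcases hA1 with rfl | rfl <;> omega
    · refine sum_wt_Vr_le_of_fst hg hr T hT fun v hv w hw => ?_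
      have e := (haff v hv).trans (haff w hw).symm
      have e' : (c ⟨0, by omega⟩ + ∑ t : Fin g, c ⟨2 * t + 1, by omega⟩) *
          ((v ⟨0, by omega⟩ : ℤ) - w ⟨0, by omega⟩) = 0 := by
        linear_combination e
      rcases mul_eq_zero.1 e' with h' | h'
      · exact absurd h' h0
      · exact_mod_cast sub_eq_zero.1 h'

/-- Power saving for a sum over `Vr g r₁` weighted by a power of an admissible affine form. -/
lemma sum_Vr_aff_le {g r₁ : ℕ} (hg : 0 < g) (hr : 0 < r₁) {β : ℝ} (hβ : 0 < β)
    {c : Fin (2 * g + 1) → ℤ} {D : ℤ} (hc : Adm c D)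
    (T : Finset (Fin (2 * g + 1) → ℕ)) (hT : ∀ v ∈ T, v ∈ Vr g r₁) :
    ∑ v ∈ T with 1 ≤ aff c D v, wt (alph g) v * (aff c D v : ℝ) ^ (-β) ≤
      2 * tailConst g * (r₁ : ℝ) ^ (-(min 1 β * (g * gam g) / 2)) := by
  have hr1 : (1 : ℝ) ≤ r₁ := by exact_mod_cast hr
  have hr' : (0 : ℝ) < r₁ := by linarith
  have hC := tailConst_pos hg
  have hg' : (0 : ℝ) < g := by exact_mod_cast hg
  have hgg : 0 < g * gam g := mul_pos hg' (gam_pos g)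
  have hgg1 : g * gam g ≤ 1 := by linarith [alph_eq_one_sub g, alph_pos g]
  have hK : (r₁ : ℝ) ^ (g * gam g / 2) ≤ r₁ := by
    calc _ ≤ (r₁ : ℝ) ^ (1 : ℝ) := Real.rpow_le_rpow_of_exponent_le hr1 (by linarith)
      _ = r₁ := Real.rpow_one _
  refine (sum_rpow_neg_le_of_levels T (fun v _ => wt_nonneg _ v) (aff c D) (K := r₁ ^ (g * gam g / 2))
    (M := tailConst g * (r₁ : ℝ) ^ (-(g * gam g))) (S := tailConst g) hβ.le (by positivity)
    (by positivity) ?_ (sum_wt_Vr_le_const hg hr T hT)).trans ?_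
  · intro f hf hfK
    refine sum_wt_Vr_level_le hg hr hc hf (by exact_mod_cast hfK.trans_le hK) _
      (fun v hv => hT v (Finset.mem_filter.1 hv).1) fun v hv => (Finset.mem_filter.1 hv).2
  · rw [← Real.rpow_mul hr'.le, mul_left_comm, ← Real.rpow_add hr']
    have h1 : (r₁ : ℝ) ^ (g * gam g / 2 + -(g * gam g)) ≤
        (r₁ : ℝ) ^ (-(min 1 β * (g * gam g) / 2)) :=
      Real.rpow_le_rpow_of_exponent_le hr1 (by nlinarith [min_le_left 1 β])
    have h2 : (r₁ : ℝ) ^ (g * gam g / 2 * -β) ≤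
        (r₁ : ℝ) ^ (-(min 1 β * (g * gam g) / 2)) :=
      Real.rpow_le_rpow_of_exponent_le hr1 (by nlinarith [min_le_right 1 β])
    nlinarith

/-- The coordinate `p i` is at most `G`, the other two are at least `n / 4`, and the total
is `n`. -/
def Tri (i : Fin 3) (n : ℕ) (G : ℝ) (p : Fin 3 → ℕ) : Prop :=
  1 ≤ p i ∧ (p i : ℝ) ≤ G ∧ (n : ℝ) / 4 ≤ p (i + 1) ∧ (n : ℝ) / 4 ≤ p (i + 2) ∧
    p i + p (i + 1) + p (i + 2) = n

lemma prod_fin_three_cyclic {A : Type*} [CommMonoid A] (f : Fin 3 → A) (i : Fin 3) :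
    ∏ j, f j = f i * f (i + 1) * f (i + 2) := by
  rw [Fin.prod_univ_three]
  fin_cases i
  · rfl
  · change f 0 * f 1 * f 2 = f 1 * f 2 * f 0
    rw [mul_assoc, mul_comm]
  · change f 0 * f 1 * f 2 = f 2 * f 0 * f 1
    rw [mul_comm, mul_assoc]

lemma sum_fin_three_cyclic {A : Type*} [AddCommMonoid A] (f : Fin 3 → A) (i : Fin 3) :
    ∑ j, f j = f i + f (i + 1) + f (i + 2) :=
  prod_fin_three_cyclic (A := Multiplicative A) f i

lemma fin_three_cyclic (i j : Fin 3) : j = i ∨ j = i + 1 ∨ j = i + 2 := by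
  revert i j; decide

lemma fin_three_ext {p q : Fin 3 → ℕ} (i : Fin 3) (h0 : p i = q i) (h1 : p (i + 1) = q (i + 1))
    (h2 : p (i + 2) = q (i + 2)) : p = q := by
  funext j
  rcases fin_three_cyclic i j with rfl | rfl | rfl <;> assumption

lemma wt_le_of_Tri {g n : ℕ} (hg : 0 < g) (hn : 0 < n) {i : Fin 3} {G : ℝ} {p : Fin 3 → ℕ}
    (hp : Tri i n G p) :
    wt (alph g) p ≤ 16 * (n : ℝ) ^ (-(1 + gam g)) * (p i : ℝ) ^ (-alph g) := by
  have hn' : (0 : ℝ) < n := by exact_mod_cast hn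
  have ha := alph_pos g
  have h4 : ∀ x : ℕ, (n : ℝ) / 4 ≤ x → (x : ℝ) ^ (-alph g) ≤ 4 * (n : ℝ) ^ (-alph g) := by
    intro x hx
    calc (x : ℝ) ^ (-alph g) ≤ ((n : ℝ) / 4) ^ (-alph g) :=
          Real.rpow_le_rpow_of_nonpos (by positivity) hx (by linarith)
      _ = 4 ^ alph g * (n : ℝ) ^ (-alph g) := by
          rw [Real.div_rpow hn'.le (by norm_num), Real.rpow_neg (by norm_num : (0 : ℝ) ≤ 4),
            div_inv_eq_mul, mul_comm]
      _ ≤ 4 * (n : ℝ) ^ (-alph g) := by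
          gcongr
          calc (4 : ℝ) ^ alph g ≤ 4 ^ (1 : ℝ) :=
                Real.rpow_le_rpow_of_exponent_le (by norm_num) (alph_lt_one hg).le
            _ = 4 := by norm_num
  rw [wt, prod_fin_three_cyclic _ i, ← two_mul_alph, mul_assoc, mul_comm]
  refine mul_le_mul_of_nonneg_right ?_ (by positivity)
  calc _ ≤ (4 * (n : ℝ) ^ (-alph g)) * (4 * (n : ℝ) ^ (-alph g)) :=
        mul_le_mul (h4 _ hp.2.2.1) (h4 _ hp.2.2.2.1) (by positivity) (by positivity)
    _ = _ := by
        rw [show -(2 * alph g) = -alph g + -alph g by ring, Real.rpow_add hn']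
        ring

lemma Tri.snd_mem {n : ℕ} (hn : 0 < n) {i : Fin 3} {G : ℝ} {p : Fin 3 → ℕ} (hp : Tri i n G p) :
    p (i + 1) ∈ Finset.Icc 1 n := by
  have hn' : (0 : ℝ) < n := by exact_mod_cast hn
  have h : (0 : ℝ) < p (i + 1) := by linarith [hp.2.2.1]
  have h' : 0 < p (i + 1) := by exact_mod_cast h
  have := hp.2.2.2.2
  rw [Finset.mem_Icc]
  omega

section Triples

variable {g n : ℕ} {i : Fin 3} {G L : ℝ} {Q : Finset (Fin 3 → ℕ)}

lemma sum_wt_Tri_le (hg : 0 < g) (hn : 0 < n) (hG : 0 ≤ G)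
    (hL : G ^ (1 - alph g) / (1 - alph g) ≤ (n : ℝ) ^ gam g * L) (hQ : ∀ p ∈ Q, Tri i n G p) :
    ∑ p ∈ Q, wt (alph g) p ≤ 16 * L := by
  have hn' : (0 : ℝ) < n := by exact_mod_cast hn
  calc _ ≤ ∑ z ∈ Finset.Icc 1 ⌊G⌋₊ ×ˢ Finset.Icc 1 n,
        16 * (n : ℝ) ^ (-(1 + gam g)) * (z.1 : ℝ) ^ (-alph g) := by
        refine sum_le_sum_of_map (fun p => (p i, p (i + 1))) ?_ ?_
          (fun p hp => wt_le_of_Tri hg hn (hQ p hp)) (fun _ _ => by positivity)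
        · intro p hp
          exact Finset.mem_product.2 ⟨Finset.mem_Icc.2 ⟨(hQ p hp).1,
            Nat.le_floor (hQ p hp).2.1⟩, (hQ p hp).snd_mem hn⟩
        · intro p hp q hq hpq
          rw [Prod.mk.injEq] at hpq
          refine fin_three_ext i hpq.1 hpq.2 ?_
          have h1 := (hQ p hp).2.2.2.2
          have h2 := (hQ q hq).2.2.2.2
          omega
    _ = 16 * (n : ℝ) ^ (-(1 + gam g)) * n *
        ∑ u ∈ Finset.Icc 1 ⌊G⌋₊, (u : ℝ) ^ (-alph g) := by
        rw [Finset.sum_product, Finset.mul_sum]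
        refine Finset.sum_congr rfl fun u _ => ?_
        dsimp only
        rw [Finset.sum_const, Nat.card_Icc, nsmul_eq_mul, Nat.add_sub_cancel]
        ring
    _ ≤ 16 * (n : ℝ) ^ (-(1 + gam g)) * n * ((n : ℝ) ^ gam g * L) := by
        gcongr
        refine (sum_rpow_neg_le_of_le (alph_pos g).le (alph_lt_one hg) hG fun u hu => ?_).trans hL
        rw [Finset.mem_Icc] at hu
        exact ⟨hu.1, (Nat.le_floor_iff hG).1 hu.2⟩
    _ = 16 * L := by
        rw [neg_add, Real.rpow_add hn', Real.rpow_neg_one, Real.rpow_neg hn'.le]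
        field_simp

lemma sum_wt_Tri_le_of_injOn (hg : 0 < g) (hn : 0 < n) (hG : 0 ≤ G) (hL0 : 0 ≤ L)
    (hL : G ^ (1 - alph g) / (1 - alph g) ≤ (n : ℝ) ^ gam g * L) (hQ : ∀ p ∈ Q, Tri i n G p)
    (hinj : ∀ p ∈ Q, ∀ q ∈ Q, p i = q i → p = q) :
    ∑ p ∈ Q, wt (alph g) p ≤ 16 * L * (n : ℝ) ^ (-gam g) := by
  have hn' : (0 : ℝ) < n := by exact_mod_cast hn
  have hn1 : (1 : ℝ) ≤ n := by exact_mod_cast hn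
  calc _ ≤ ∑ u ∈ Finset.Icc 1 ⌊G⌋₊,
        16 * (n : ℝ) ^ (-(1 + gam g)) * (u : ℝ) ^ (-alph g) := by
        refine sum_le_sum_of_map (fun p => p i) ?_ (fun p hp q hq h => hinj p hp q hq h)
          (fun p hp => wt_le_of_Tri hg hn (hQ p hp)) (fun _ _ => by positivity)
        intro p hp
        exact Finset.mem_Icc.2 ⟨(hQ p hp).1, Nat.le_floor (hQ p hp).2.1⟩
    _ ≤ 16 * (n : ℝ) ^ (-(1 + gam g)) * ((n : ℝ) ^ gam g * L) := by
        rw [← Finset.mul_sum]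
        gcongr
        refine (sum_rpow_neg_le_of_le (alph_pos g).le (alph_lt_one hg) hG fun u hu => ?_).trans hL
        rw [Finset.mem_Icc] at hu
        exact ⟨hu.1, (Nat.le_floor_iff hG).1 hu.2⟩
    _ = 16 * L * (n : ℝ) ^ (-1 : ℝ) := by
        rw [neg_add, Real.rpow_add hn', Real.rpow_neg hn'.le (gam g)]
        field_simp
    _ ≤ _ := by
        gcongr
        exact gam_le_one g

lemma sum_wt_Tri_le_of_const (hg : 0 < g) (hn : 0 < n) (hL1 : 1 ≤ L) (hQ : ∀ p ∈ Q, Tri i n G p)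
    (hc : ∀ p ∈ Q, ∀ q ∈ Q, p i = q i) :
    ∑ p ∈ Q, wt (alph g) p ≤ 16 * L * (n : ℝ) ^ (-gam g) := by
  have hn' : (0 : ℝ) < n := by exact_mod_cast hn
  calc _ ≤ ∑ u ∈ Finset.Icc 1 n, 16 * (n : ℝ) ^ (-(1 + gam g)) := by
        refine sum_le_sum_of_map (fun p => p (i + 1)) (fun p hp => (hQ p hp).snd_mem hn) ?_ ?_
          (fun _ _ => by positivity)
        · intro p hp q hq hpq
          have h0 := hc p hp q hq
          refine fin_three_ext i h0 hpq ?_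
          have h1 := (hQ p hp).2.2.2.2
          have h2 := (hQ q hq).2.2.2.2
          dsimp only at hpq
          omega
        · intro p hp
          exact (wt_le_of_Tri hg hn (hQ p hp)).trans (mul_le_of_le_one_right (by positivity)
            (rpow_neg_le_one_of_pos (alph_pos g).le (hQ p hp).1))
    _ = 16 * 1 * (n : ℝ) ^ (-gam g) := by
        rw [Finset.sum_const, Nat.card_Icc, nsmul_eq_mul, Nat.add_sub_cancel, neg_add,
          Real.rpow_add hn', Real.rpow_neg_one]
        field_simp
    _ ≤ _ := by gcongr

lemma sum_wt_Tri_level_le (hg : 0 < g) (hn : 0 < n) (hG : 0 ≤ G) (hL1 : 1 ≤ L)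
    (hL : G ^ (1 - alph g) / (1 - alph g) ≤ (n : ℝ) ^ gam g * L) (hQ : ∀ p ∈ Q, Tri i n G p)
    {c : Fin 3 → ℤ} {D : ℤ} (hc : Adm c D) {f : ℤ} (hf : 1 ≤ f) (hfn : f < n)
    (hQf : ∀ p ∈ Q, aff c D p = f) :
    ∑ p ∈ Q, wt (alph g) p ≤ 16 * L * (n : ℝ) ^ (-gam g) := by
  have haff : ∀ p ∈ Q, c i * (p i : ℤ) + c (i + 1) * (p (i + 1) : ℤ) +
      c (i + 2) * ((n : ℤ) - p i - p (i + 1)) + D = f := by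
    intro p hp
    rw [← hQf p hp, aff, sum_fin_three_cyclic _ i]
    have h := (hQ p hp).2.2.2.2
    zify at h
    rw [← h]
    ring
  by_cases h12 : c (i + 1) = c (i + 2)
  · by_cases h0 : c i = c (i + 2)
    · rcases Q.eq_empty_or_nonempty with rfl | ⟨p, hp⟩
      · simp only [Finset.sum_empty]; positivity
      exfalso
      have e := haff p hp
      rw [h12, h0] at e
      have e' : c (i + 2) * n + D = f := by linear_combination e
      obtain ⟨⟨j, hj⟩, h3, hD⟩ := hc
      have hne : c (i + 2) ≠ 0 := by
        rcases fin_three_cyclic i j with rfl | rfl | rfl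
        · rwa [h0] at hj
        · rwa [h12] at hj
        · exact hj
      rw [sum_fin_three_cyclic _ i, h12, h0] at h3 hD
      have hpos := abs_pos.2 hne
      have h1 : |c (i + 2)| = 1 := by omega
      have hD0 : D = 0 := by omega
      rw [hD0, add_zero] at e'
      rcases eq_or_eq_neg_of_abs_eq h1 with h | h <;> rw [h] at e' <;> omega
    · refine sum_wt_Tri_le_of_const hg hn hL1 hQ fun p hp q hq => ?_
      have e := (haff p hp).trans (haff q hq).symm
      have e' : (c i - c (i + 2)) * ((p i : ℤ) - q i) = 0 := by
        rw [h12] at e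
        linear_combination e
      rcases mul_eq_zero.1 e' with h' | h'
      · exact absurd (sub_eq_zero.1 h') h0
      · exact_mod_cast sub_eq_zero.1 h'
  · refine sum_wt_Tri_le_of_injOn hg hn hG (by linarith) hL hQ fun p hp q hq hpq => ?_
    have e := (haff p hp).trans (haff q hq).symm
    rw [hpq] at e
    have e' : (c (i + 1) - c (i + 2)) * ((p (i + 1) : ℤ) - q (i + 1)) = 0 := by
      linear_combination e
    have h1 : p (i + 1) = q (i + 1) := by
      rcases mul_eq_zero.1 e' with h' | h'
      · exact absurd (sub_eq_zero.1 h') h12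
      · exact_mod_cast sub_eq_zero.1 h'
    refine fin_three_ext i hpq h1 ?_
    have h1 := (hQ p hp).2.2.2.2
    have h2 := (hQ q hq).2.2.2.2
    omega

lemma sum_Tri_aff_le (hg : 0 < g) (hn : 0 < n) (hG : 0 ≤ G) (hL1 : 1 ≤ L)
    (hL : G ^ (1 - alph g) / (1 - alph g) ≤ (n : ℝ) ^ gam g * L) (hQ : ∀ p ∈ Q, Tri i n G p)
    {c : Fin 3 → ℤ} {D : ℤ} (hc : Adm c D) {β : ℝ} (hβ : 0 < β) :
    ∑ p ∈ Q with 1 ≤ aff c D p, wt (alph g) p * (aff c D p : ℝ) ^ (-β) ≤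
      32 * L * (n : ℝ) ^ (-(min 1 β * gam g / 2)) := by
  have hn1 : (1 : ℝ) ≤ n := by exact_mod_cast hn
  have hn' : (0 : ℝ) < n := by linarith
  have hγ := gam_pos g
  have hK : (n : ℝ) ^ (gam g / 2) ≤ n := by
    calc _ ≤ (n : ℝ) ^ (1 : ℝ) :=
          Real.rpow_le_rpow_of_exponent_le hn1 (by linarith [gam_le_one g])
      _ = n := Real.rpow_one _
  refine (sum_rpow_neg_le_of_levels Q (fun v _ => wt_nonneg _ v) (aff c D)
    (K := n ^ (gam g / 2)) (M := 16 * L * (n : ℝ) ^ (-gam g)) (S := 16 * L) hβ.le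
    (by positivity) (by positivity) ?_ (sum_wt_Tri_le hg hn hG hL hQ)).trans ?_
  · intro f hf hfK
    exact sum_wt_Tri_level_le hg hn hG hL1 hL (fun p hp => hQ p (Finset.mem_filter.1 hp).1) hc hf
      (by exact_mod_cast hfK.trans_le hK) fun v hv => (Finset.mem_filter.1 hv).2
  · rw [← Real.rpow_mul hn'.le, mul_left_comm, ← Real.rpow_add hn']
    have h1 : (n : ℝ) ^ (gam g / 2 + -gam g) ≤ (n : ℝ) ^ (-(min 1 β * gam g / 2)) :=
      Real.rpow_le_rpow_of_exponent_le hn1 (by nlinarith [min_le_left 1 β])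
    have h2 : (n : ℝ) ^ (gam g / 2 * -β) ≤ (n : ℝ) ^ (-(min 1 β * gam g / 2)) :=
      Real.rpow_le_rpow_of_exponent_le hn1 (by nlinarith [min_le_right 1 β])
    nlinarith

end Triples

section Pattern

variable {m k : ℕ} {r : Finset ℕ}

/-- The sequence `y` obtained by choosing, for each of the first `k` places, a coordinate of `x` or
an element of `r`. -/
def pat (σ : Fin k → Fin m ⊕ r) (x : Fin m → ℕ) : ℕ → ℕ :=
  fun j => if h : j < k then Sum.elim x (fun a : r => (a : ℕ)) (σ ⟨j, h⟩) else 0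

def patCoef (eps : ℕ → ℤ) (σ : Fin k → Fin m ⊕ r) (i : Fin m) : ℤ :=
  ∑ j : Fin k, if σ j = Sum.inl i then eps j else 0

def patConst (eps : ℕ → ℤ) (σ : Fin k → Fin m ⊕ r) : ℤ :=
  ∑ j : Fin k, Sum.elim (fun _ => (0 : ℤ)) (fun a : r => eps j * ((a : ℕ) : ℤ)) (σ j)

lemma pat_apply (σ : Fin k → Fin m ⊕ r) (x : Fin m → ℕ) (j : Fin k) :
    pat σ x j = Sum.elim x (fun a : r => (a : ℕ)) (σ j) := by
  simp [pat]

lemma Fval_pat (eps : ℕ → ℤ) (σ : Fin k → Fin m ⊕ r) (x : Fin m → ℕ) :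
    Fval k eps (pat σ x) = aff (patCoef eps σ) (patConst eps σ) x := by
  rw [Fval, ← Fin.sum_univ_eq_sum_range (fun j => eps j * (pat σ x j : ℤ)), aff, patConst]
  simp only [patCoef, Finset.sum_mul]
  rw [Finset.sum_comm, ← Finset.sum_add_distrib]
  refine Finset.sum_congr rfl fun j _ => ?_
  rw [pat_apply]
  rcases h : σ j with i | a <;> simp

lemma adm_pat (hk : k ≤ 3) {eps : ℕ → ℤ} (heps : ∀ j, eps j = 1 ∨ eps j = -1)
    {σ : Fin k → Fin m ⊕ r} {x : Fin m → ℕ} (hx : imgF x ∩ r = ∅)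
    (hy : pat σ x ∈ Tcal (imgF x) r k eps) : Adm (patCoef eps σ) (patConst eps σ) := by
  obtain ⟨-, -, ⟨j₀, hj₀, hj₀x⟩, hsgn⟩ := hy
  have habs : ∑ i, |patCoef eps σ i| ≤ ∑ j : Fin k, if (σ j).isLeft then (1 : ℤ) else 0 := by
    calc _ ≤ ∑ i, ∑ j : Fin k, |if σ j = Sum.inl i then eps j else 0| :=
          Finset.sum_le_sum fun i _ => Finset.abs_sum_le_sum_abs _ _
      _ = ∑ j : Fin k, ∑ i, |if σ j = Sum.inl i then eps j else 0| := Finset.sum_comm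
      _ = _ := by
          refine Finset.sum_congr rfl fun j _ => ?_
          have h1 : |eps j| = 1 := by rcases heps j with h | h <;> simp [h]
          rcases h : σ j with i | a <;> simp [apply_ite abs, h1]
  have hk' : (k : ℤ) ≤ 3 := by exact_mod_cast hk
  refine ⟨?_, ?_, ?_⟩
  · rw [show j₀ = ((⟨j₀, hj₀⟩ : Fin k) : ℕ) from rfl, pat_apply] at hj₀x
    rcases h : σ ⟨j₀, hj₀⟩ with i | a
    · refine ⟨i, ?_⟩
      have e : patCoef eps σ i = ∑ j : Fin k, if σ j = Sum.inl i then eps j₀ else 0 := by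
        refine Finset.sum_congr rfl fun j _ => ?_
        split_ifs with hj
        · refine hsgn j j.2 j₀ hj₀ ?_
          rw [pat_apply, show j₀ = ((⟨j₀, hj₀⟩ : Fin k) : ℕ) from rfl, pat_apply, h, hj]
        · rfl
      rw [e, ← Finset.sum_filter, Finset.sum_const, nsmul_eq_mul]
      refine mul_ne_zero ?_ (by rcases heps j₀ with h | h <;> simp [h])
      rw [Nat.cast_ne_zero, Finset.card_ne_zero]
      exact ⟨⟨j₀, hj₀⟩, Finset.mem_filter.2 ⟨Finset.mem_univ _, h⟩⟩
    · rw [h] at hj₀x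
      exact absurd (Finset.mem_inter.2 ⟨hj₀x, a.2⟩) (by rw [hx]; simp)
  · refine habs.trans (le_trans ?_ hk')
    calc _ ≤ ∑ j : Fin k, (1 : ℤ) := Finset.sum_le_sum fun j _ => by split_ifs <;> simp
      _ = k := by simp
  · by_cases hall : ∀ j, (σ j).isLeft
    · left
      refine Finset.sum_eq_zero fun j _ => ?_
      obtain ⟨i, hi⟩ := Sum.isLeft_iff.1 (hall j)
      rw [hi, Sum.elim_inl]
    · right
      push Not at hall
      obtain ⟨j₁, hj₁⟩ := hall
      have hlt : ∑ j : Fin k, (if (σ j).isLeft then (1 : ℤ) else 0) < ∑ j : Fin k, (1 : ℤ) :=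
        Finset.sum_lt_sum (fun j _ => by split_ifs <;> simp) ⟨j₁, Finset.mem_univ _, by simp [hj₁]⟩
      have : ∑ j : Fin k, (1 : ℤ) = k := by simp
      omega

lemma exists_pat_eq {eps : ℕ → ℤ} {x : Fin m → ℕ} {y : ℕ → ℕ}
    (hy : y ∈ Tcal (imgF x) r k eps) : ∃ σ : Fin k → Fin m ⊕ r, pat σ x = y := by
  have h : ∀ j : Fin k, ∃ z : Fin m ⊕ r, Sum.elim x (fun a : r => (a : ℕ)) z = y j := by
    intro j
    rcases Finset.mem_union.1 (hy.1 j j.2) with h | h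
    · obtain ⟨i, -, hi⟩ := Finset.mem_image.1 h
      exact ⟨Sum.inl i, hi⟩
    · exact ⟨Sum.inr ⟨_, h⟩, rfl⟩
  choose σ hσ using h
  refine ⟨σ, funext fun j => ?_⟩
  by_cases hj : j < k
  · simpa [pat, hj] using hσ ⟨j, hj⟩
  · simp [pat, hj, hy.2.1 j (by omega)]

open Classical in
lemma tsum_Tcal_le (eps : ℕ → ℤ) (x : Fin m → ℕ) (β : ℝ) :
    ∑' y : ↥{y ∈ Tcal (imgF x) r k eps | 1 ≤ Fval k eps y}, ((Fval k eps y.1 : ℝ)) ^ (-β) ≤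
      ∑ σ : Fin k → Fin m ⊕ r,
        if pat σ x ∈ Tcal (imgF x) r k eps ∧ 1 ≤ Fval k eps (pat σ x)
        then (Fval k eps (pat σ x) : ℝ) ^ (-β) else 0 := by
  have hnn : ∀ σ : Fin k → Fin m ⊕ r,
      0 ≤ if pat σ x ∈ Tcal (imgF x) r k eps ∧ 1 ≤ Fval k eps (pat σ x)
        then (Fval k eps (pat σ x) : ℝ) ^ (-β) else 0 := by
    intro σ
    split_ifs with h
    · have : (0 : ℝ) ≤ Fval k eps (pat σ x) := by exact_mod_cast (by linarith [h.2])
      positivity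
    · rfl
  choose e he using fun y : ↥{y ∈ Tcal (imgF x) r k eps | 1 ≤ Fval k eps y} =>
    exists_pat_eq y.2.1
  refine tsum_le_of_sum_le' (Finset.sum_nonneg fun σ _ => hnn σ) fun s => ?_
  refine sum_le_sum_of_map e (fun _ _ => Finset.mem_univ _) ?_ ?_ fun σ _ => hnn σ
  · intro y _ z _ hyz
    rw [Subtype.ext_iff, ← he y, ← he z, hyz]
  · intro y _
    rw [he y, if_pos ⟨y.2.1, y.2.2⟩]

/-- Reduction of a sum over tuples `x` and sequences `y` to sums over `x` weighted by powers of
admissible affine forms. -/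
lemma tsum_tuple_le (hm : 0 < m) (hk : k ≤ 3) {eps : ℕ → ℤ} (heps : ∀ j, eps j = 1 ∨ eps j = -1)
    (A : Set (Fin m → ℕ)) {a β B : ℝ} (hB : 0 ≤ B)
    (h : ∀ T : Finset (Fin m → ℕ), (∀ x ∈ T, x ∈ A) → ∀ c D, Adm c D →
      ∑ x ∈ T with 1 ≤ aff c D x, wt a x * (aff c D x : ℝ) ^ (-β) ≤ B) :
    ∑' x : ↥{x ∈ A | imgF x ∩ r = ∅}, (∏ i, (x.1 i : ℝ) ^ (-a)) *
        ∑' y : ↥{y ∈ Tcal (imgF x.1) r k eps | 1 ≤ Fval k eps y},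
          ((Fval k eps y.1 : ℝ)) ^ (-β) ≤
      ((m : ℝ) + r.card) ^ 3 * B := by
  classical
  refine tsum_le_of_sum_le' (by positivity) fun s => ?_
  set T : Finset (Fin m → ℕ) := s.map (Function.Embedding.subtype _) with hTdef
  have hT : ∀ x ∈ T, x ∈ A ∧ imgF x ∩ r = ∅ := by
    intro x hx
    obtain ⟨z, -, rfl⟩ := Finset.mem_map.1 hx
    exact z.2
  have e1 : ∑ x ∈ s, (∏ i, (x.1 i : ℝ) ^ (-a)) *
        ∑' y : ↥{y ∈ Tcal (imgF x.1) r k eps | 1 ≤ Fval k eps y},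
          ((Fval k eps y.1 : ℝ)) ^ (-β) =
      ∑ x ∈ T, wt a x * ∑' y : ↥{y ∈ Tcal (imgF x) r k eps | 1 ≤ Fval k eps y},
          ((Fval k eps y.1 : ℝ)) ^ (-β) := by
    rw [hTdef, Finset.sum_map]
    rfl
  rw [e1]
  calc _ ≤ ∑ x ∈ T, wt a x * ∑ σ : Fin k → Fin m ⊕ r,
        (if pat σ x ∈ Tcal (imgF x) r k eps ∧ 1 ≤ Fval k eps (pat σ x)
        then (Fval k eps (pat σ x) : ℝ) ^ (-β) else 0) :=
        Finset.sum_le_sum fun x _ =>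
          mul_le_mul_of_nonneg_left (tsum_Tcal_le eps x β) (wt_nonneg _ _)
    _ = ∑ σ : Fin k → Fin m ⊕ r, ∑ x ∈ T with
          pat σ x ∈ Tcal (imgF x) r k eps ∧ 1 ≤ Fval k eps (pat σ x),
            wt a x * (Fval k eps (pat σ x) : ℝ) ^ (-β) := by
        simp only [Finset.mul_sum, Finset.sum_filter, mul_ite, mul_zero]
        exact Finset.sum_comm
    _ ≤ ∑ σ : Fin k → Fin m ⊕ r, B := by
        refine Finset.sum_le_sum fun σ _ => ?_
        by_cases hex : ∃ x ∈ T, pat σ x ∈ Tcal (imgF x) r k eps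
        · obtain ⟨x₀, hx₀, hx₀'⟩ := hex
          refine le_trans ?_ (h T (fun x hx => (hT x hx).1) _ _
            (adm_pat hk heps (hT x₀ hx₀).2 hx₀'))
          simp only [Fval_pat]
          refine Finset.sum_le_sum_of_subset_of_nonneg ?_ ?_
          · intro x hx
            rw [Finset.mem_filter] at hx ⊢
            exact ⟨hx.1, hx.2.2⟩
          · intro x hx _
            have h0 : (0 : ℝ) ≤ aff (patCoef eps σ) (patConst eps σ) x := by
              exact_mod_cast (by linarith [(Finset.mem_filter.1 hx).2])
            exact mul_nonneg (wt_nonneg _ _) (by positivity)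
        · push Not at hex
          rw [Finset.filter_false_of_mem fun x hx => not_and_of_not_left _ (hex x hx)]
          simpa using hB
    _ ≤ _ := by
        rw [Finset.sum_const, nsmul_eq_mul, Finset.card_univ]
        refine mul_le_mul_of_nonneg_right ?_ hB
        rw [Fintype.card_fun, Fintype.card_sum, Fintype.card_fin, Fintype.card_fin,
          Fintype.card_coe]
        push_cast
        refine pow_le_pow_right₀ ?_ hk
        have h1 : (1 : ℝ) ≤ m := by exact_mod_cast hm
        have h2 : (0 : ℝ) ≤ r.card := Nat.cast_nonneg _
        linarith

end Pattern

section HeadTail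

variable {g : ℕ}

/-- The first three entries. -/
def hd {A : Type*} (x : Fin (2 * g + 4) → A) : Fin 3 → A := fun j => x ⟨j, by omega⟩

/-- The entries from the fourth on. -/
def tl {A : Type*} (x : Fin (2 * g + 4) → A) : Fin (2 * g + 1) → A :=
  fun i => x ⟨i + 3, by omega⟩

lemma hd_tl_ext {A : Type*} {x y : Fin (2 * g + 4) → A} (h : hd x = hd y) (h' : tl x = tl y) :
    x = y := by
  funext ⟨i, hi⟩
  by_cases h3 : i < 3
  · exact congrFun h ⟨i, h3⟩
  · have := congrFun h' ⟨i - 3, by omega⟩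
    simp only [tl, Nat.sub_add_cancel (not_lt.1 h3)] at this
    exact this

@[to_additive]
lemma prod_hd_tl {A : Type*} [CommMonoid A] (f : Fin (2 * g + 4) → A) :
    ∏ i, f i = (∏ j, hd f j) * ∏ i, tl f i := by
  rw [Fin.prod_univ_succ, Fin.prod_univ_succ, Fin.prod_univ_succ, Fin.prod_univ_three, mul_assoc,
    mul_assoc]
  rfl

lemma wt_hd_tl (a : ℝ) (x : Fin (2 * g + 4) → ℕ) : wt a x = wt a (hd x) * wt a (tl x) :=
  prod_hd_tl _

lemma aff_hd_tl (c : Fin (2 * g + 4) → ℤ) (D : ℤ) (x : Fin (2 * g + 4) → ℕ) :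
    aff c D x = aff (tl c) (aff (hd c) D (hd x)) (tl x) := by
  rw [aff, sum_hd_tl, aff, aff, add_comm (∑ j, hd _ j), add_assoc]
  rfl

lemma adm_tl {c : Fin (2 * g + 4) → ℤ} {D : ℤ} (hc : Adm c D) (ht : ∃ i, tl c i ≠ 0)
    (p : Fin 3 → ℕ) : Adm (tl c) (aff (hd c) D p) := by
  obtain ⟨-, h3, hD⟩ := hc
  rw [sum_hd_tl] at h3 hD
  change ∑ j, |hd c j| + ∑ i, |tl c i| ≤ 3 at h3
  change D = 0 ∨ ∑ j, |hd c j| + ∑ i, |tl c i| ≤ 2 at hD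
  have hnn : 0 ≤ ∑ j, |hd c j| := Finset.sum_nonneg fun _ _ => abs_nonneg _
  refine ⟨ht, by omega, ?_⟩
  by_cases h0 : ∑ j, |hd c j| = 0
  · have hz : ∀ j, hd c j = 0 := fun j => abs_eq_zero.1
      ((Finset.sum_eq_zero_iff_of_nonneg fun _ _ => abs_nonneg _).1 h0 j (Finset.mem_univ j))
    rw [h0] at hD
    simp only [aff, hz, zero_mul, Finset.sum_const_zero, zero_add]
    simpa using hD
  · right; omega

lemma adm_hd {c : Fin (2 * g + 4) → ℤ} {D : ℤ} (hc : Adm c D) (ht : ∀ i, tl c i = 0) :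
    Adm (hd c) D := by
  obtain ⟨⟨⟨i, hi'⟩, hi⟩, h3, hD⟩ := hc
  rw [sum_hd_tl] at h3 hD
  change ∑ j, |hd c j| + ∑ i, |tl c i| ≤ 3 at h3
  change D = 0 ∨ ∑ j, |hd c j| + ∑ i, |tl c i| ≤ 2 at hD
  simp only [ht, abs_zero, Finset.sum_const_zero, add_zero] at h3 hD
  refine ⟨?_, h3, hD⟩
  by_contra hall
  push Not at hall
  have : c = fun _ => 0 := hd_tl_ext (funext hall) (funext ht)
  exact hi (congrFun this _)

lemma tl_mem_Vr {M n : ℕ} {lam : ℝ} {s : ℕ → Fin 3 → ZMod M} {x : Fin (2 * g + 4) → ℕ}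
    (hx : x ∈ TnInd g M lam s n) : tl x ∈ Vr g (hd x 0) := by
  obtain ⟨⟨hpos, -, hsum, hle, -, -⟩, hinj⟩ := hx
  refine ⟨fun i => hpos _, ?_, fun i => hle _ (by simp), ?_, ?_⟩
  · intro t ht
    have h := hsum (t + 2) (by omega) (by omega)
    have h1 : (⟨2 * (t + 2), by omega⟩ : Fin (2 * g + 4)) = ⟨2 * t + 1 + 3, by omega⟩ :=
      Fin.ext (Nat.mul_add 2 t 2)
    have h2 : (⟨2 * (t + 2) + 1, by omega⟩ : Fin (2 * g + 4)) = ⟨2 * t + 2 + 3, by omega⟩ :=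
      Fin.ext (congrArg Nat.succ (Nat.mul_add 2 t 2))
    rw [h1, h2] at h
    exact h
  · intro i j hij
    have := hinj hij
    simpa [Fin.ext_iff] using this
  · intro i hi
    exact absurd (congrArg Fin.val (hinj hi)) (Nat.succ_ne_zero _)

lemma exists_cyclic_of_mem {p : Fin 3 → ℕ} (hp : Function.Injective p) {a b c : ℕ}
    (h : ∀ j, p j = a ∨ p j = b ∨ p j = c) :
    ∃ i, p i = a ∧ (p (i + 1) = b ∧ p (i + 2) = c ∨ p (i + 1) = c ∧ p (i + 2) = b) := by
  have h01 : p 0 ≠ p 1 := hp.ne (by decide)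
  have h02 : p 0 ≠ p 2 := hp.ne (by decide)
  have h12 : p 1 ≠ p 2 := hp.ne (by decide)
  have h0 := h 0
  have h1 := h 1
  have h2 := h 2
  by_cases e0 : p 0 = a
  · refine ⟨0, e0, ?_⟩
    change p 1 = b ∧ p 2 = c ∨ p 1 = c ∧ p 2 = b
    omega
  by_cases e1 : p 1 = a
  · refine ⟨1, e1, ?_⟩
    change p 2 = b ∧ p 0 = c ∨ p 2 = c ∧ p 0 = b
    omega
  · refine ⟨2, by omega, ?_⟩
    change p 0 = b ∧ p 1 = c ∨ p 0 = c ∧ p 1 = b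
    omega

lemma hd_spec {M n : ℕ} {lam : ℝ} {s : ℕ → Fin 3 → ZMod M} {x : Fin (2 * g + 4) → ℕ}
    (hx : x ∈ TnInd g M lam s n) :
    (∃ i, Tri i n (glam g lam n) (hd x)) ∧
      (glam g lam n / 2 ≤ hd x 0 ∨ (n : ℝ) / 4 ≤ hd x 0) := by
  obtain ⟨⟨-, ⟨a, b, c, hset, ha, -, -, hsum, h1, h2, h3, -, h4, -⟩, -⟩, hinj⟩ := hx
  have hmem : ∀ j, hd x j = a ∨ hd x j = b ∨ hd x j = c := by
    intro j
    have : hd x j ∈ firstThree g x := by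
      rcases fin_three_cyclic 0 j with rfl | rfl | rfl <;> simp [firstThree, hd]
    rw [hset] at this
    simpa using this
  constructor
  · have hp : Function.Injective (hd x) := by
      intro i j hij
      have := hinj hij
      simpa [Fin.ext_iff] using this
    obtain ⟨i, hi, ⟨hb, hc⟩ | ⟨hc, hb⟩⟩ := exists_cyclic_of_mem hp hmem
    · refine ⟨i, ?_⟩
      rw [Tri, hi, hb, hc]
      exact ⟨ha, h2, h3, h4, hsum⟩
    · refine ⟨i, ?_⟩
      rw [Tri, hi, hb, hc]
      exact ⟨ha, h2, h4, h3, by omega⟩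
  · rcases hmem 0 with h | h | h <;> rw [h]
    · exact Or.inl h1
    · exact Or.inr h3
    · exact Or.inr h4

lemma sum_le_three_mul {n : ℕ} {G B : ℝ} {P : Finset (Fin 3 → ℕ)} {f : (Fin 3 → ℕ) → ℝ}
    (hP : ∀ p ∈ P, ∃ i, Tri i n G p) (hf : ∀ p ∈ P, 0 ≤ f p)
    (h : ∀ i, ∀ Q ⊆ P, (∀ p ∈ Q, Tri i n G p) → ∑ p ∈ Q, f p ≤ B) :
    ∑ p ∈ P, f p ≤ 3 * B := by
  classical
  calc _ ≤ ∑ p ∈ P, ∑ i, if Tri i n G p then f p else 0 := by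
        refine Finset.sum_le_sum fun p hp => ?_
        obtain ⟨i, hi⟩ := hP p hp
        calc f p = if Tri i n G p then f p else 0 := (if_pos hi).symm
          _ ≤ _ := Finset.single_le_sum (f := fun i => if Tri i n G p then f p else 0)
            (fun j _ => by split_ifs; exacts [hf p hp, le_rfl]) (Finset.mem_univ i)
    _ = ∑ i, ∑ p ∈ P with Tri i n G p, f p := by
        rw [Finset.sum_comm]
        simp only [Finset.sum_filter]
    _ ≤ ∑ i : Fin 3, B := Finset.sum_le_sum fun i _ =>
        h i _ (Finset.filter_subset _ _) fun p hp => (Finset.mem_filter.1 hp).2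
    _ = 3 * B := by simp

/-- Power saving for a sum over independent tuples weighted by a power of an admissible affine
form. -/
lemma sum_TnInd_aff_le {M n : ℕ} {lam : ℝ} {s : ℕ → Fin 3 → ZMod M} (hg : 0 < g) (hn : 0 < n)
    {L : ℝ} (hG : 0 ≤ glam g lam n) (hL1 : 1 ≤ L)
    (hL : glam g lam n ^ (1 - alph g) / (1 - alph g) ≤ (n : ℝ) ^ gam g * L)
    (hlow : (n : ℝ) ^ ((1 : ℝ) / g) ≤ glam g lam n / 2)
    (hlow' : (n : ℝ) ^ ((1 : ℝ) / g) ≤ (n : ℝ) / 4) {β : ℝ} (hβ : 0 < β)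
    {c : Fin (2 * g + 4) → ℤ} {D : ℤ} (hc : Adm c D)
    (T : Finset (Fin (2 * g + 4) → ℕ)) (hT : ∀ x ∈ T, x ∈ TnInd g M lam s n) :
    ∑ x ∈ T with 1 ≤ aff c D x, wt (alph g) x * (aff c D x : ℝ) ^ (-β) ≤
      96 * tailConst g * L * (n : ℝ) ^ (-(min 1 β * gam g / 2)) := by
  classical
  have hn' : (0 : ℝ) < n := by exact_mod_cast hn
  have hg' : (0 : ℝ) < g := by exact_mod_cast hg
  have htc := tailConst_pos hg
  have hγ := gam_pos g
  have hb : 0 < min 1 β := lt_min one_pos hβ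
  set P := T.image hd with hPdef
  have hPT : ∀ p ∈ P, ∃ x ∈ T, hd x = p := fun p hp => Finset.mem_image.1 hp
  have hP : ∀ p ∈ P, ∃ i, Tri i n (glam g lam n) p := by
    intro p hp
    obtain ⟨x, hx, rfl⟩ := hPT p hp
    exact (hd_spec (hT x hx)).1
  have hP0 : ∀ p ∈ P, (n : ℝ) ^ ((1 : ℝ) / g) ≤ p 0 := by
    intro p hp
    obtain ⟨x, hx, rfl⟩ := hPT p hp
    rcases (hd_spec (hT x hx)).2 with h | h
    · exact hlow.trans h
    · exact hlow'.trans h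
  have hP1 : ∀ p ∈ P, 0 < p 0 := by
    intro p hp
    have h : (0 : ℝ) < p 0 := lt_of_lt_of_le (by positivity) (hP0 p hp)
    exact_mod_cast h
  let V : (Fin 3 → ℕ) → Finset (Fin (2 * g + 1) → ℕ) := fun p =>
    (T.filter fun x => hd x = p).image tl
  have hV : ∀ p, ∀ v ∈ V p, v ∈ Vr g (p 0) := by
    intro p v hv
    obtain ⟨x, hx, rfl⟩ := Finset.mem_image.1 hv
    rw [Finset.mem_filter] at hx
    rw [← hx.2]
    exact tl_mem_Vr (hT x hx.1)
  have hfib : ∑ x ∈ T with 1 ≤ aff c D x, wt (alph g) x * (aff c D x : ℝ) ^ (-β) ≤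
      ∑ p ∈ P, wt (alph g) p * ∑ v ∈ V p with 1 ≤ aff (tl c) (aff (hd c) D p) v,
        wt (alph g) v * (aff (tl c) (aff (hd c) D p) v : ℝ) ^ (-β) := by
    rw [← Finset.sum_fiberwise_of_maps_to (t := P) (g := hd) fun x hx =>
      Finset.mem_image_of_mem _ (Finset.mem_filter.1 hx).1]
    refine Finset.sum_le_sum fun p _ => ?_
    rw [Finset.mul_sum]
    refine sum_le_sum_of_map tl ?_ ?_ ?_ ?_
    · intro x hx
      simp only [Finset.mem_filter] at hx
      refine Finset.mem_filter.2 ⟨Finset.mem_image_of_mem _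
        (Finset.mem_filter.2 ⟨hx.1.1, hx.2⟩), ?_⟩
      rw [← hx.2, ← aff_hd_tl]
      exact hx.1.2
    · intro x hx y hy hxy
      simp only [Finset.coe_filter, Finset.mem_filter, Set.mem_ofPred_eq] at hx hy
      exact hd_tl_ext (hx.2.trans hy.2.symm) hxy
    · intro x hx
      rw [Finset.mem_filter] at hx
      rw [wt_hd_tl, mul_assoc, aff_hd_tl, hx.2]
    · intro v hv
      have h0 : (0 : ℝ) ≤ aff (tl c) (aff (hd c) D p) v := by
        exact_mod_cast (by linarith [(Finset.mem_filter.1 hv).2])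
      exact mul_nonneg (wt_nonneg _ _) (mul_nonneg (wt_nonneg _ _) (by positivity))
  refine hfib.trans ?_
  by_cases ht : ∃ i, tl c i ≠ 0
  · calc _ ≤ ∑ p ∈ P, wt (alph g) p *
          (2 * tailConst g * (n : ℝ) ^ (-(min 1 β * gam g / 2))) := by
          refine Finset.sum_le_sum fun p hp => mul_le_mul_of_nonneg_left ?_ (wt_nonneg _ _)
          refine (sum_Vr_aff_le hg (hP1 p hp) hβ (adm_tl hc ht p) (V p) (hV p)).trans ?_
          refine mul_le_mul_of_nonneg_left ?_ (by positivity)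
          calc _ ≤ ((n : ℝ) ^ ((1 : ℝ) / g)) ^ (-(min 1 β * (g * gam g) / 2)) :=
                Real.rpow_le_rpow_of_nonpos (by positivity) (hP0 p hp)
                  (neg_nonpos.2 (by positivity))
            _ = _ := by
                rw [← Real.rpow_mul hn'.le]
                congr 1
                field_simp
      _ ≤ 3 * (16 * L) * (2 * tailConst g * (n : ℝ) ^ (-(min 1 β * gam g / 2))) := by
          rw [← Finset.sum_mul]
          refine mul_le_mul_of_nonneg_right ?_ (by positivity)
          exact sum_le_three_mul hP (fun p _ => wt_nonneg _ p) fun i Q _ hQ =>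
            sum_wt_Tri_le hg hn hG hL hQ
      _ = _ := by ring
  · push Not at ht
    have hz : ∀ E v, aff (tl c) E v = E := by
      intro E v
      simp [aff, ht]
    simp only [hz]
    calc _ ≤ ∑ p ∈ P with 1 ≤ aff (hd c) D p,
          tailConst g * (wt (alph g) p * (aff (hd c) D p : ℝ) ^ (-β)) := by
          rw [Finset.sum_filter]
          refine Finset.sum_le_sum fun p hp => ?_
          split_ifs with h
          · have h0 : (0 : ℝ) ≤ aff (hd c) D p := by exact_mod_cast (by linarith)
            simp only [h, Finset.filter_true]
            rw [← Finset.sum_mul, ← mul_assoc, mul_right_comm, mul_comm (tailConst g)]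
            exact mul_le_mul_of_nonneg_left (sum_wt_Vr_le_const hg (hP1 p hp) (V p) (hV p))
              (mul_nonneg (wt_nonneg _ _) (by positivity))
          · simp [h]
      _ ≤ tailConst g * (3 * (32 * L * (n : ℝ) ^ (-(min 1 β * gam g / 2)))) := by
          rw [← Finset.mul_sum]
          refine mul_le_mul_of_nonneg_left ?_ htc.le
          refine sum_le_three_mul (n := n) (G := glam g lam n)
            (fun p hp => hP p (Finset.mem_filter.1 hp).1) ?_ ?_
          · intro p hp
            have h0 : (0 : ℝ) ≤ aff (hd c) D p := by
              exact_mod_cast (by linarith [(Finset.mem_filter.1 hp).2])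
            exact mul_nonneg (wt_nonneg _ _) (by positivity)
          · intro i Q hQP hQ
            rw [← Finset.filter_true_of_mem fun p hp => (Finset.mem_filter.1 (hQP hp)).2]
            exact sum_Tri_aff_le hg hn hG hL1 hL hQ (adm_hd hc ht) hβ
      _ = _ := by ring

end HeadTail

lemma glam_rpow {g n : ℕ} (hg : 0 < g) (hn : 1 ≤ n) {lam : ℝ} (hlam : 0 < lam) :
    glam g lam n ^ (1 - alph g) = lam ^ (2 * (g : ℝ) + 5) * (n : ℝ) ^ gam g * Real.log n := by
  have h1 : 1 - alph g ≠ 0 := by linarith [alph_lt_one hg]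
  have hg' : (g : ℝ) ≠ 0 := by exact_mod_cast hg.ne'
  have hl : 0 ≤ Real.log n := Real.log_nonneg (by exact_mod_cast hn)
  rw [glam, Real.mul_rpow (by positivity) (by positivity), Real.mul_rpow (by positivity)
    (by positivity), ← Real.rpow_mul hlam.le, ← Real.rpow_mul (by positivity),
    ← Real.rpow_mul hl, div_mul_cancel₀ _ h1, div_mul_cancel₀ _ h1, Real.rpow_one,
    show 1 / (g : ℝ) * (1 - alph g) = gam g by rw [alph_eq_one_sub]; field_simp; ring]

lemma two_le_log {n : ℕ} (hn : 16 ≤ n) : 2 ≤ Real.log n := by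
  have h : Real.log ((2 : ℝ) ^ 4) ≤ Real.log n :=
    Real.log_le_log (by norm_num) (by norm_num; exact_mod_cast hn)
  rw [Real.log_pow] at h
  push_cast at h
  linarith [Real.log_two_gt_d9]

lemma rpow_le_half_glam {g n : ℕ} (hg : 0 < g) (hn : 16 ≤ n) {lam : ℝ} (hlam : 1 < lam) :
    (n : ℝ) ^ ((1 : ℝ) / g) ≤ glam g lam n / 2 := by
  have h1 : 0 < 1 - alph g := by linarith [alph_lt_one hg]
  have hl := two_le_log hn
  have ha : 1 ≤ lam ^ ((2 * (g : ℝ) + 5) / (1 - alph g)) :=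
    Real.one_le_rpow hlam.le (by positivity)
  have hb : 2 ≤ Real.log n ^ ((1 : ℝ) / (1 - alph g)) := by
    refine hl.trans ?_
    calc Real.log n = Real.log n ^ (1 : ℝ) := (Real.rpow_one _).symm
      _ ≤ _ := Real.rpow_le_rpow_of_exponent_le (by linarith)
        ((le_div_iff₀ h1).2 (by linarith [alph_pos g]))
  rw [le_div_iff₀ (by norm_num), glam, mul_comm (lam ^ _), mul_assoc]
  refine mul_le_mul_of_nonneg_left ?_ (by positivity)
  nlinarith

lemma rpow_le_div_four {g n : ℕ} (hg : 2 ≤ g) (hn : 16 ≤ n) :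
    (n : ℝ) ^ ((1 : ℝ) / g) ≤ (n : ℝ) / 4 := by
  have hn' : (16 : ℝ) ≤ n := by exact_mod_cast hn
  have hg' : (2 : ℝ) ≤ g := by exact_mod_cast hg
  calc (n : ℝ) ^ ((1 : ℝ) / g) ≤ (n : ℝ) ^ ((1 : ℝ) / 2) :=
        Real.rpow_le_rpow_of_exponent_le (by linarith)
          (one_div_le_one_div_of_le (by norm_num) hg')
    _ = √n := (Real.sqrt_eq_rpow _).symm
    _ ≤ _ := Real.sqrt_le_iff.2 ⟨by positivity, by nlinarith⟩

theorem stmt14 (g M : ℕ) (hg : 2 ≤ g) (hM : 1 ≤ M) (CM : Set (ZMod M))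
    (hSidon : IsSidonZ CM) (hcov : Covers3 CM) (β : ℝ) (hβ : 0 < β) :
    ∃ δ : ℝ, 0 < δ ∧
      ∀ s : ℕ → Fin 3 → ZMod M, GoodS M CM s →
      ∀ lam : ℝ, 1 < lam → ∃ C : ℝ, 0 < C ∧ ∃ n₀ : ℕ, ∀ n : ℕ, n₀ ≤ n →
      ∀ r : Finset ℕ, (∀ a ∈ r, 1 ≤ a ∧ a ≤ n) → r.card ≤ 2 * g + 4 →
      ∀ k : ℕ, 1 ≤ k → k ≤ 3 → ∀ eps : ℕ → ℤ, (∀ j, eps j = 1 ∨ eps j = -1) →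
        ((∑' x : ↥{x ∈ TnInd g M lam s n | imgF x ∩ r = ∅},
            (∏ i : Fin (2 * g + 4), (x.1 i : ℝ) ^ (-alph g)) *
              ∑' y : ↥{y ∈ Tcal (imgF x.1) r k eps | 1 ≤ Fval k eps y},
                ((Fval k eps y.1 : ℝ)) ^ (-β)) ≤ C * (n : ℝ) ^ (-δ)) ∧
        (∀ r₁ : ℕ, (n : ℝ) ^ ((1 : ℝ) / (g : ℝ)) ≤ (r₁ : ℝ) →
          (∑' v : ↥{v ∈ Vr g r₁ | imgF v ∩ r = ∅},
            (∏ i : Fin (2 * g + 1), (v.1 i : ℝ) ^ (-alph g)) *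
              ∑' y : ↥{y ∈ Tcal (imgF v.1) r k eps | 1 ≤ Fval k eps y},
                ((Fval k eps y.1 : ℝ)) ^ (-β)) ≤ C * (n : ℝ) ^ (-δ)) := by
  classical
  have hg0 : 0 < g := by omega
  have hgam := gam_pos g
  have htc := tailConst_pos hg0
  have h1a : 0 < 1 - alph g := sub_pos.2 (alph_lt_one hg0)
  have hm0 : 0 < min 1 β := lt_min one_pos hβ
  set e : ℝ := min 1 β * gam g / 4 with he
  have he0 : 0 < e := by positivity
  refine ⟨e, he0, fun s hs lam hlam => ?_⟩
  have hlam0 : 0 < lam := by linarith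
  set Λ : ℝ := lam ^ (2 * (g : ℝ) + 5) / (1 - alph g) with hΛ
  have hlam1 : 1 ≤ lam ^ (2 * (g : ℝ) + 5) := Real.one_le_rpow hlam.le (by positivity)
  have hΛ1 : 1 ≤ Λ := by
    rw [hΛ, le_div_iff₀ h1a]
    have := alph_pos g
    linarith
  refine ⟨(4 * (g : ℝ) + 8) ^ 3 * (96 * tailConst g * Λ / e + 2 * tailConst g),
    by positivity, 16, fun n hn r _ hrc k _ hk eps heps => ?_⟩
  have hn0 : 0 < n := by omega
  have hn1 : (1 : ℝ) ≤ n := by exact_mod_cast hn0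
  have hnR : (0 : ℝ) < n := by linarith
  have hrc' : (r.card : ℝ) ≤ 2 * g + 4 := by exact_mod_cast hrc
  have hlog := two_le_log hn
  have key : ∀ {m : ℝ} {S B B' : ℝ}, 0 ≤ m → m ≤ 2 * (g : ℝ) + 4 → 0 ≤ B' →
      S ≤ (m + r.card) ^ 3 * B → B ≤ B' * (n : ℝ) ^ (-e) →
      B' ≤ 96 * tailConst g * Λ / e + 2 * tailConst g →
      S ≤ (4 * (g : ℝ) + 8) ^ 3 * (96 * tailConst g * Λ / e + 2 * tailConst g) *
        (n : ℝ) ^ (-e) := by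
    intro m S B B' hm hm' hB' hS hB hBC
    refine hS.trans ((mul_le_mul_of_nonneg_left hB (by positivity)).trans ?_)
    rw [mul_assoc]
    have : m + r.card ≤ 4 * (g : ℝ) + 8 := by linarith
    gcongr
  constructor
  · have hL1 : 1 ≤ Λ * Real.log n := by nlinarith
    have hlow := rpow_le_half_glam hg0 hn hlam
    have hG : 0 ≤ glam g lam n := by
      have : (0 : ℝ) ≤ (n : ℝ) ^ ((1 : ℝ) / (g : ℝ)) := by positivity
      linarith
    refine key (m := ((2 * g + 4 : ℕ) : ℝ)) (B := 96 * tailConst g * (Λ * Real.log n) *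
        (n : ℝ) ^ (-(min 1 β * gam g / 2))) (B' := 96 * tailConst g * Λ / e)
      (by positivity) (by push_cast; rfl) (by positivity)
      (tsum_tuple_le (by omega) hk heps _ (by positivity) fun T hT c D hc =>
        sum_TnInd_aff_le hg0 hn0 hG hL1 ?_ hlow (rpow_le_div_four hg hn) hβ hc T hT)
      ?_ (by linarith)
    · rw [glam_rpow hg0 hn0 hlam0, hΛ]
      exact le_of_eq (by ring)
    · have hl : Real.log n ≤ (n : ℝ) ^ e / e := Real.log_le_rpow_div hnR.le he0
      have hsplit : (n : ℝ) ^ (-e) = (n : ℝ) ^ e * (n : ℝ) ^ (-(min 1 β * gam g / 2)) := by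
        rw [← Real.rpow_add hnR]
        congr 1
        rw [he]
        ring
      calc 96 * tailConst g * (Λ * Real.log n) * (n : ℝ) ^ (-(min 1 β * gam g / 2))
          ≤ 96 * tailConst g * (Λ * ((n : ℝ) ^ e / e)) *
              (n : ℝ) ^ (-(min 1 β * gam g / 2)) := by gcongr
        _ = 96 * tailConst g * Λ / e * (n : ℝ) ^ (-e) := by
          rw [hsplit]
          ring
  · intro r₁ hr₁
    have hgR : (0 : ℝ) < g := by exact_mod_cast hg0
    have hr₁1 : (1 : ℝ) ≤ r₁ := (Real.one_le_rpow hn1 (by positivity)).trans hr₁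
    have hr₁0 : 0 < r₁ := by exact_mod_cast hr₁1
    refine key (m := ((2 * g + 1 : ℕ) : ℝ))
      (B := 2 * tailConst g * (r₁ : ℝ) ^ (-(min 1 β * (g * gam g) / 2)))
      (B' := 2 * tailConst g)
      (by positivity) (by push_cast; linarith) (by positivity)
      (tsum_tuple_le (by omega) hk heps _ (by positivity) fun T hT c D hc =>
        sum_Vr_aff_le hg0 hr₁0 hβ hc T hT) ?_ (by
          have : 0 ≤ 96 * tailConst g * Λ / e := by positivity
          linarith)
    gcongr
    calc (r₁ : ℝ) ^ (-(min 1 β * (g * gam g) / 2))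
        ≤ ((n : ℝ) ^ ((1 : ℝ) / (g : ℝ))) ^ (-(min 1 β * (g * gam g) / 2)) :=
          Real.rpow_le_rpow_of_nonpos (by positivity) hr₁
            (neg_nonpos.2 (by positivity))
      _ = (n : ℝ) ^ (-(min 1 β * gam g / 2)) := by
          rw [← Real.rpow_mul hnR.le]
          congr 1
          field_simp
      _ ≤ (n : ℝ) ^ (-e) :=
          Real.rpow_le_rpow_of_exponent_le hn1 (by
            rw [he]
            linarith [mul_pos hm0 hgam])
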